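/- arXiv:1503.05076 — 5 statements merged into one kernel-verified Lean document; each statement's English description precedes it below -/
import Mathlib

section
/- Every finite 3-colourable simple graph is word-representable. -/
/-- Two distinct letters `x` and `y` alternate in the word `w` if, after deleting all
letters other than `x` and `y` from `w`, no two consecutive letters of the resulting
word are equal (i.e. it reads `xyxy...` or `yxyx...`). -/
def Alternates {V : Type*} [DecidableEq V] (w : List V) (x y : V) : Prop :=
  List.Chain' (· ≠ ·) (w.filter fun z => z = x ∨ z = y)

/-- A finite simple graph `G = (V, E)` is word-representable if there is a word over the
alphabet `V` in which every element of `V` occurs at least once and such that, for all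
distinct `x, y ∈ V`, the letters `x` and `y` alternate in the word iff `{x, y} ∈ E`. -/
def WordRepresentable {V : Type*} [DecidableEq V] (G : SimpleGraph V) : Prop :=
  ∃ w : List V, (∀ v : V, v ∈ w) ∧
    ∀ x y : V, x ≠ y → (G.Adj x y ↔ Alternates w x y)

section helpers
variable {V : Type*} [Fintype V] [DecidableEq V]

noncomputable def seg (p : V → Bool) : List V := (Finset.univ : Finset V).toList.filter p

def restr (u v : V) (w : List V) : List V := w.filter fun z => z = u ∨ z = v

theorem restr_append (u v : V) (a b : List V) :
    restr u v (a ++ b) = restr u v a ++ restr u v b := by simp [restr]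

theorem mem_seg (p : V → Bool) (v : V) : v ∈ seg p ↔ p v = true := by simp [seg]

theorem nodup_restr {l : List V} (hl : l.Nodup) (u v : V) (h : ¬ (u ∈ l ∧ v ∈ l)) :
    restr u v l = (if u ∈ l then [u] else []) ++ (if v ∈ l then [v] else []) := by
  have key : ∀ a b : V, b ∉ l → l.filter (fun z => decide (z = a ∨ z = b)) =
      if a ∈ l then [a] else [] := by
    intro a b hb
    have h1 : l.filter (fun z => decide (z = a ∨ z = b)) = l.filter (fun z => z == a) := by
      apply List.filter_congr
      intro z hz
      have : z ≠ b := fun e => hb (e ▸ hz)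
      simp only [this, or_false]; rfl
    rw [h1, List.filter_beq]
    split_ifs with ha
    · rw [List.count_eq_one_of_mem hl ha]; rfl
    · rw [List.count_eq_zero_of_not_mem ha]; rfl
  by_cases hv : v ∈ l
  · have hu : u ∉ l := fun hu => h ⟨hu, hv⟩
    have := key v u hu
    simp only [hu, hv, if_true, if_false, List.nil_append] at this ⊢
    rw [← this]
    unfold restr
    congr 1
    funext z
    simp [or_comm]
  · have := key u v hv
    simp only [hv, if_false, List.append_nil]
    exact this

theorem restr_seg (p : V → Bool) (u v : V) (h : ¬ (p u = true ∧ p v = true)) :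
    restr u v (seg p) = (if p u then [u] else []) ++ (if p v then [v] else []) := by
  have hn : (seg p).Nodup := (Finset.nodup_toList _).filter _
  have := nodup_restr hn u v (by simpa [mem_seg] using h)
  simpa only [mem_seg] using this

def Good (G : SimpleGraph V) (c : V → Fin 3) (w : List V) : Prop :=
  ∀ u v, G.Adj u v → c u < c v → ∃ n, restr u v w = (List.replicate n [u, v]).flatten

theorem Good.append {G : SimpleGraph V} {c : V → Fin 3} {a b : List V}
    (ha : Good G c a) (hb : Good G c b) : Good G c (a ++ b) := by
  intro u v h1 h2
  obtain ⟨n, hn⟩ := ha u v h1 h2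
  obtain ⟨m, hm⟩ := hb u v h1 h2
  exact ⟨n + m, by rw [restr_append, hn, hm, List.replicate_add, List.flatten_append]⟩

theorem Good.flatten {G : SimpleGraph V} {c : V → Fin 3} {L : List (List V)}
    (h : ∀ a ∈ L, Good G c a) : Good G c L.flatten := by
  induction L with
  | nil => intro u v _ _; exact ⟨0, by simp [restr]⟩
  | cons a L ih =>
    rw [List.flatten_cons]
    exact (h a (by simp)).append (ih fun b hb => h b (by simp [hb]))

theorem chain_rep {u v : V} (h : u ≠ v) (n : ℕ) :
    List.IsChain (· ≠ ·) (List.replicate n [u, v]).flatten := by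
  induction n with
  | zero => simp
  | succ n ih =>
    cases n with
    | zero => simp [h]
    | succ n =>
      simp only [List.replicate_succ, List.flatten_cons, List.cons_append, List.nil_append] at ih ⊢
      simp only [List.isChain_cons_cons] at ih ⊢
      exact ⟨h, h.symm, ih⟩

theorem alt_iff (w : List V) (x y : V) : Alternates w x y ↔ List.IsChain (· ≠ ·) (restr x y w) :=
  Iff.rfl

theorem alt_symm (w : List V) (x y : V) : Alternates w x y ↔ Alternates w y x := by
  have : restr x y w = restr y x w := by
    unfold restr; congr 1; funext z; simp [or_comm]
  rw [alt_iff, alt_iff, this]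

theorem alt_infix {a w : List V} (h : a <:+: w) {x y : V} (hw : Alternates w x y) :
    Alternates a x y := by
  rw [alt_iff] at *
  exact hw.infix (h.filter _)

theorem fin3 (i : Fin 3) : i = 0 ∨ i = 1 ∨ i = 2 := by omega

set_option maxHeartbeats 2000000 in
theorem gadget (G : SimpleGraph V) (c : V → Fin 3) (x y : V) (hxy : x ≠ y)
    (hn : ¬ G.Adj x y) (hc : c x ≤ c y) : ∃ w, Good G c w ∧ ¬ Alternates w x y := by
  have good_of : ∀ w : List V, (∀ u v, G.Adj u v → c u < c v → restr u v w = [u, v, u, v]) →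
      Good G c w := fun w h u v h1 h2 => ⟨2, by rw [h u v h1 h2]; rfl⟩
  rcases hc.eq_or_lt with he | hlt
  · refine ⟨seg (fun z => c z = 0 ∧ z = x) ++ (seg (fun z => c z = 0 ∧ z ≠ x) ++
      (seg (fun z => c z = 1 ∧ z = x) ++ (seg (fun z => c z = 1 ∧ z ≠ x) ++
      (seg (fun z => c z = 2 ∧ z = x) ++ (seg (fun z => c z = 2 ∧ z ≠ x) ++
      (seg (fun z => c z = 0 ∧ z ≠ x) ++ (seg (fun z => c z = 0 ∧ z = x) ++
      (seg (fun z => c z = 1 ∧ z ≠ x) ++ (seg (fun z => c z = 1 ∧ z = x) ++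
      (seg (fun z => c z = 2 ∧ z ≠ x) ++ (seg (fun z => c z = 2 ∧ z = x)))))))))))),
      good_of _ ?_, ?_⟩
    · intro u v h1 h2
      simp only [restr_append]
      rcases fin3 (c u) with hu | hu | hu <;> rcases fin3 (c v) with hv | hv | hv <;>
        simp [hu, hv] at h2 <;>
        (repeat rw [restr_seg _ u v (by simp [hu, hv])]) <;>
        by_cases hux : u = x <;> by_cases hvx : v = x <;> simp_all
    · rw [alt_iff]
      simp only [restr_append]
      have hyx := hxy.symm
      (repeat rw [restr_seg _ x y (by simp [hyx])])
      rcases fin3 (c y) with hv | hv | hv <;> simp [he, hv, hyx]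
  · have hyx := hxy.symm
    have h3 : (c x = 0 ∧ c y = 1) ∨ (c x = 1 ∧ c y = 2) ∨ (c x = 0 ∧ c y = 2) := by omega
    rcases h3 with ⟨hx, hy⟩ | ⟨hx, hy⟩ | ⟨hx, hy⟩
    · refine ⟨seg (fun z => c z = 0) ++ (seg (fun z => c z = 1) ++ (seg (fun z => c z = 2) ++
        (seg (fun z => c z = 0 ∧ z ≠ x) ++ (seg (fun z => z = y) ++ (seg (fun z => z = x) ++
        (seg (fun z => c z = 1 ∧ z ≠ y) ++ seg (fun z => c z = 2))))))), good_of _ ?_, ?_⟩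
      · intro u v h1 h2
        have huv := h1.ne
        simp only [restr_append]
        rcases fin3 (c u) with hu | hu | hu <;> rcases fin3 (c v) with hv | hv | hv <;>
          simp [hu, hv] at h2 <;>
          (repeat rw [restr_seg _ u v (by first | (simp [hu, hv]; done) | grind)]) <;>
          by_cases hux : u = x <;> by_cases hvx : v = x <;>
          by_cases huy : u = y <;> by_cases hvy : v = y <;> simp_all
      · rw [alt_iff]
        simp only [restr_append]
        (repeat rw [restr_seg _ x y (by first | (simp [hx, hy]; done) | grind)])
        simp [hx, hy, hxy, hyx]
    · refine ⟨seg (fun z => c z = 0) ++ (seg (fun z => c z = 1) ++ (seg (fun z => c z = 2) ++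
        (seg (fun z => c z = 0) ++ (seg (fun z => c z = 1 ∧ z ≠ x) ++ (seg (fun z => z = y) ++
        (seg (fun z => z = x) ++ seg (fun z => c z = 2 ∧ z ≠ y))))))), good_of _ ?_, ?_⟩
      · intro u v h1 h2
        have huv := h1.ne
        simp only [restr_append]
        rcases fin3 (c u) with hu | hu | hu <;> rcases fin3 (c v) with hv | hv | hv <;>
          simp [hu, hv] at h2 <;>
          (repeat rw [restr_seg _ u v (by first | (simp [hu, hv]; done) | grind)]) <;>
          by_cases hux : u = x <;> by_cases hvx : v = x <;>
          by_cases huy : u = y <;> by_cases hvy : v = y <;> simp_all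
      · rw [alt_iff]
        simp only [restr_append]
        (repeat rw [restr_seg _ x y (by first | (simp [hx, hy]; done) | grind)])
        simp [hx, hy, hxy, hyx]
    · refine ⟨seg (fun z => c z = 0) ++ (seg (fun z => c z = 1) ++
        (seg (fun z => c z = 2 ∧ z ≠ y) ++ (seg (fun z => z = x) ++ (seg (fun z => z = y) ++
        (seg (fun z => c z = 0 ∧ z ≠ x) ++
        (seg (fun z => c z = 1) ++ seg (fun z => c z = 2))))))), good_of _ ?_, ?_⟩
      · intro u v h1 h2
        have huv := h1.ne
        simp only [restr_append]
        rcases fin3 (c u) with hu | hu | hu <;> rcases fin3 (c v) with hv | hv | hv <;>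
          simp [hu, hv] at h2 <;>
          (repeat rw [restr_seg _ u v (by first | (simp [hu, hv]; done) | grind)]) <;>
          by_cases hux : u = x <;> by_cases hvx : v = x <;>
          by_cases huy : u = y <;> by_cases hvy : v = y <;> simp_all
      · rw [alt_iff]
        simp only [restr_append]
        (repeat rw [restr_seg _ x y (by first | (simp [hx, hy]; done) | grind)])
        simp [hx, hy, hxy, hyx]

theorem base_good (G : SimpleGraph V) (c : V → Fin 3) :
    Good G c (seg (fun z => c z = 0) ++ (seg (fun z => c z = 1) ++ seg (fun z => c z = 2))) := by
  intro u v h1 h2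
  refine ⟨1, ?_⟩
  simp only [restr_append]
  rcases fin3 (c u) with hu | hu | hu <;> rcases fin3 (c v) with hv | hv | hv <;>
    simp [hu, hv] at h2 <;>
    (repeat rw [restr_seg _ u v (by simp [hu, hv])]) <;> simp [hu, hv]

end helpers

/-- Every finite 3-colourable simple graph is word-representable. -/
theorem wordRepresentable_of_colorable_three {V : Type*} [Fintype V] [DecidableEq V]
    (G : SimpleGraph V) (h : G.Colorable 3) : WordRepresentable G := by
  obtain ⟨c⟩ := h
  have hg : ∀ p : V × V, ∃ w, Good G c w ∧
      (p.1 ≠ p.2 → ¬ G.Adj p.1 p.2 → ¬ Alternates w p.1 p.2) := by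
    rintro ⟨x, y⟩
    by_cases hxy : x = y
    · exact ⟨_, base_good G c, fun h => absurd hxy h⟩
    by_cases hn : G.Adj x y
    · exact ⟨_, base_good G c, fun _ h => absurd hn h⟩
    rcases le_total (c x) (c y) with hc | hc
    · obtain ⟨w, h1, h2⟩ := gadget G c x y hxy hn hc
      exact ⟨w, h1, fun _ _ => h2⟩
    · obtain ⟨w, h1, h2⟩ := gadget G c y x (Ne.symm hxy) (fun h => hn h.symm) hc
      exact ⟨w, h1, fun _ _ => by rwa [alt_symm]⟩
  choose g hgood hg using hg
  set base := seg (fun z => c z = 0) ++ (seg (fun z => c z = 1) ++ seg (fun z => c z = 2)) with hb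
  set R := ((Finset.univ : Finset (V × V)).toList.map g).flatten with hR
  have hW : Good G c (base ++ R) := by
    refine (base_good G c).append (Good.flatten ?_)
    intro a ha
    obtain ⟨p, -, rfl⟩ := List.mem_map.1 ha
    exact hgood p
  have main : ∀ x y, G.Adj x y → c x < c y → Alternates (base ++ R) x y := by
    intro x y h1 h2
    obtain ⟨n, hn⟩ := hW x y h1 h2
    rw [alt_iff, hn]
    exact chain_rep h1.ne n
  refine ⟨base ++ R, ?_, ?_⟩
  · intro v
    rw [List.mem_append]
    left
    simp only [hb, List.mem_append, mem_seg]
    simpa using fin3 (c v)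
  · intro x y hxy
    constructor
    · intro h1
      rcases lt_or_gt_of_ne (c.valid h1) with h2 | h2
      · exact main x y h1 h2
      · rw [alt_symm]; exact main y x h1.symm h2
    · intro ha
      by_contra hn
      refine hg (x, y) hxy hn (alt_infix ?_ ha)
      have h1 : g (x, y) <:+: R :=
        List.infix_of_mem_flatten (List.mem_map.2 ⟨(x, y), by simp, rfl⟩)
      exact h1.trans (List.suffix_append _ _).isInfix
end

section
/- Every triangulation of a rectangular polyomino with a single domino tile is word-representable if and only if it is 3-colourable. -/
/-- The vertices of the `m × n` rectangular polyomino: the lattice points `(x, y)` with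
`0 ≤ x ≤ m` and `0 ≤ y ≤ n`. -/
abbrev GridV (m n : ℕ) := {p : ℕ × ℕ // p.1 ≤ m ∧ p.2 ≤ n}

/-- A triangulation of the `m × n` rectangular polyomino with a single horizontal domino
tile occupying the two unit cells `[a, a+1] × [b, b+1]` and `[a+1, a+2] × [b, b+1]`.

Its edges are: all unit-length horizontal and vertical grid edges except the edge
`{(a+1, b), (a+1, b+1)}` interior to the domino; for every unit cell other than the two
domino cells, exactly one of its two diagonals (chosen by `diag`, as in a plain
triangulation); and three straight-line diagonal segments with endpoints among the six
boundary vertices of the domino, chosen with pairwise disjoint interiors so that together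
with the boundary they partition the `1 × 2` domino rectangle into four triangles.

Since the three bottom (resp. top) boundary vertices of the domino are collinear and the
segment `{(a+1, b), (a+1, b+1)}` is not a diagonal, there are exactly two such choices of
three diagonal segments, selected here by `dom`:
* `dom = true`:  `{(a,b),(a+2,b+1)}`, `{(a,b),(a+1,b+1)}`, `{(a+1,b),(a+2,b+1)}`;
* `dom = false`: `{(a+1,b),(a,b+1)}`, `{(a+2,b),(a+1,b+1)}`, `{(a+2,b),(a,b+1)}`.

There are no other edges. -/
def dominoTriangulationH (m n a b : ℕ) (diag : ℕ → ℕ → Bool) (dom : Bool) :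
    SimpleGraph (GridV m n) :=
  SimpleGraph.fromRel fun u v =>
    -- horizontal grid edges
    (v.1.1 = u.1.1 + 1 ∧ v.1.2 = u.1.2) ∨
    -- vertical grid edges, except the one interior to the domino
    (v.1.1 = u.1.1 ∧ v.1.2 = u.1.2 + 1 ∧ ¬(u.1.1 = a + 1 ∧ u.1.2 = b)) ∨
    -- the chosen diagonal of each unit cell other than the two domino cells
    (¬((u.1.1 = a ∨ u.1.1 = a + 1) ∧ u.1.2 = b) ∧ diag u.1.1 u.1.2 = true ∧
      v.1.1 = u.1.1 + 1 ∧ v.1.2 = u.1.2 + 1) ∨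
    (∃ i j, ¬((i = a ∨ i = a + 1) ∧ j = b) ∧ diag i j = false ∧
      u.1.1 = i + 1 ∧ u.1.2 = j ∧ v.1.1 = i ∧ v.1.2 = j + 1) ∨
    -- the three diagonal segments triangulating the domino
    (dom = true ∧
      ((u.1 = (a, b) ∧ v.1 = (a + 2, b + 1)) ∨
       (u.1 = (a, b) ∧ v.1 = (a + 1, b + 1)) ∨
       (u.1 = (a + 1, b) ∧ v.1 = (a + 2, b + 1)))) ∨
    (dom = false ∧
      ((u.1 = (a + 1, b) ∧ v.1 = (a, b + 1)) ∨
       (u.1 = (a + 2, b) ∧ v.1 = (a + 1, b + 1)) ∨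
       (u.1 = (a + 2, b) ∧ v.1 = (a, b + 1))))

/-- A triangulation of the `m × n` rectangular polyomino with a single *vertical* domino
tile occupying the two unit cells `[a, a+1] × [b, b+1]` and `[a, a+1] × [b+1, b+2]`:
it is obtained from the horizontal case by exchanging the roles of the two coordinates. -/
def dominoTriangulationV (m n a b : ℕ) (diag : ℕ → ℕ → Bool) (dom : Bool) :
    SimpleGraph (GridV m n) :=
  SimpleGraph.comap (fun p => (⟨(p.1.2, p.1.1), p.2.2, p.2.1⟩ : GridV n m))
    (dominoTriangulationH n m b a diag dom)


theorem filt_comm {V : Type*} [DecidableEq V] (w : List V) (x y : V) :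
    (w.filter fun z => z = y ∨ z = x) = (w.filter fun z => z = x ∨ z = y) := by
  congr 1; funext z; simp [or_comm]

theorem pref_iff {V : Type*} [DecidableEq V] (w : List V) : ∀ (x y : V), x ≠ y →
    ((∀ p, p <+: w → 0 ≤ (p.count x : ℤ) - p.count y ∧ (p.count x : ℤ) - p.count y ≤ 1) ↔
      (List.IsChain (· ≠ ·) (w.filter fun z => z = x ∨ z = y) ∧
        (w.filter fun z => z = x ∨ z = y).head? ≠ some y)) := by
  induction w with
  | nil => intro x y h; simp
  | cons z w ih =>
    intro x y h
    by_cases hx : z = x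
    · subst hx
      have := ih y z h.symm
      rw [filt_comm] at this
      have e : ((z :: w).filter fun t => t = z ∨ t = y) = z :: (w.filter fun t => t = z ∨ t = y) := by
        simp
      rw [e, List.isChain_cons]
      have : ((∀ p, p <+: z :: w → 0 ≤ (p.count z : ℤ) - p.count y ∧ (p.count z : ℤ) - p.count y ≤ 1)) ↔
        (∀ p, p <+: w → 0 ≤ (p.count y : ℤ) - p.count z ∧ (p.count y : ℤ) - p.count z ≤ 1) := by
        constructor
        · intro H p hp
          have := H (z :: p) (by simpa using hp)
          simp [List.count_cons, h] at this
          omega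
        · intro H p hp
          rcases List.prefix_cons_iff.1 hp with rfl | ⟨t, rfl, ht⟩
          · simp
          · have := H t ht
            simp [List.count_cons, h]
            omega
      rw [this, ih y z h.symm, filt_comm]
      constructor
      · rintro ⟨h1, h2⟩
        refine ⟨⟨?_, h1⟩, by simpa using h⟩
        rintro t ht rfl
        exact h2 ht
      · rintro ⟨⟨h1, h2⟩, h3⟩
        exact ⟨h2, fun h4 => h1 z h4 rfl⟩
    · by_cases hy : z = y
      · subst hy
        constructor
        · intro H
          have := H [z] (by simp)
          simp [List.count_cons, hx] at this
        · rintro ⟨_, h⟩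
          simp at h
      · have e : ((z :: w).filter fun t => t = x ∨ t = y) = (w.filter fun t => t = x ∨ t = y) := by
          simp [hx, hy]
        rw [e, ← ih x y h]
        constructor
        · intro H p hp
          have := H (z :: p) (by simpa using hp)
          simpa [List.count_cons, hx, hy] using this
        · intro H p hp
          rcases List.prefix_cons_iff.1 hp with rfl | ⟨t, rfl, ht⟩
          · simp
          · simpa [List.count_cons, hx, hy] using H t ht

theorem alt_iff_s2 {V : Type*} [DecidableEq V] (w : List V) (x y : V) (h : x ≠ y) :
    Alternates w x y ↔
    ((∀ p, p <+: w → 0 ≤ (p.count x : ℤ) - p.count y ∧ (p.count x : ℤ) - p.count y ≤ 1) ∨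
     (∀ p, p <+: w → 0 ≤ (p.count y : ℤ) - p.count x ∧ (p.count y : ℤ) - p.count x ≤ 1)) := by
  rw [pref_iff w x y h, pref_iff w y x h.symm, filt_comm w x y]
  unfold Alternates List.Chain'
  constructor
  · intro H
    by_cases h2 : (w.filter fun z => z = x ∨ z = y).head? = some y
    · right; refine ⟨H, ?_⟩
      rw [h2]; simpa using h.symm
    · left; exact ⟨H, h2⟩
  · rintro (H | H) <;> exact H.1

/-- Neighbourhoods in a `K₄`-free word-representable graph are bipartite. -/
theorem nbhd_bip {V : Type*} [DecidableEq V] (G : SimpleGraph V) (hw : WordRepresentable G)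
    (hK : ∀ v x y z, G.Adj v x → G.Adj v y → G.Adj v z → G.Adj x y → G.Adj y z → G.Adj x z → False)
    (v : V) : ∃ τ : V → Prop, ∀ x y, G.Adj v x → G.Adj v y → G.Adj x y → (τ x ↔ ¬ τ y) := by
  obtain ⟨w, hall, hw⟩ := hw
  have h1 : ∀ x, ∃ o : ℤ, G.Adj v x → ∀ p, p <+: w → 0 ≤ (p.count x : ℤ) + o - p.count v ∧
      (p.count x : ℤ) + o - p.count v ≤ 1 := by
    intro x
    by_cases hx : G.Adj v x
    · rcases (alt_iff_s2 w v x hx.ne).1 ((hw v x hx.ne).1 hx) with h | h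
      · refine ⟨1, fun _ p hp => ?_⟩
        have := h p hp; omega
      · refine ⟨0, fun _ p hp => ?_⟩
        have := h p hp; omega
    · exact ⟨0, fun h => absurd h hx⟩
  choose o ho using h1
  let D : V → V → Prop := fun x y => ∀ p, p <+: w → (p.count y : ℤ) + o y ≤ p.count x + o x
  have hD : ∀ x y, G.Adj v x → G.Adj v y → x ≠ y → (G.Adj x y ↔ D x y ∨ D y x) := by
    intro x y hx hy hxy
    rw [hw x y hxy, alt_iff_s2 w x y hxy]
    have n1 := ho x hx
    have n2 := ho y hy
    have z1 := n1 [] (by simp)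
    have z2 := n2 [] (by simp)
    simp at z1 z2
    constructor
    · have key : ∀ s : ℤ, (∀ p, p <+: w → s ≤ (p.count x : ℤ) - p.count y ∧
          (p.count x : ℤ) - p.count y ≤ s + 1) → D x y ∨ D y x := by
        intro s hs
        by_cases h0 : 0 ≤ s + o x - o y
        · left; intro p hp
          have := hs p hp; omega
        · right; intro p hp
          have := hs p hp; omega
      rintro (H | H)
      · exact key 0 (fun p hp => by have := H p hp; omega)
      · exact key (-1) (fun p hp => by have := H p hp; omega)
    · rintro (H | H)
      · by_cases h0 : o x = o y
        · left; intro p hp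
          have := H p hp; have := n1 p hp; have := n2 p hp; omega
        · right; intro p hp
          have := H p hp; have := n1 p hp; have := n2 p hp; have := H [] (by simp)
          simp at this; omega
      · by_cases h0 : o x = o y
        · right; intro p hp
          have := H p hp; have := n1 p hp; have := n2 p hp; omega
        · left; intro p hp
          have := H p hp; have := n1 p hp; have := n2 p hp; have := H [] (by simp)
          simp at this; omega
  have hanti : ∀ x y, x ≠ y → D x y → D y x → False := by
    intro x y hxy h1 h2
    have hc : ∀ p, p <+: w → p.count x = p.count y := by
      intro p hp
      have a1 := h1 p hp
      have a2 := h2 p hp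
      have a3 := h1 [] (by simp)
      have a4 := h2 [] (by simp)
      simp at a3 a4
      omega
    obtain ⟨s, t, hst⟩ := List.append_of_mem (hall x)
    have b1 := hc s (by rw [hst]; simp)
    have b2 := hc (s ++ [x]) (by rw [hst]; simp)
    simp [List.count_append, List.count_cons, hxy] at b2
    omega
  refine ⟨fun x => ∃ z, G.Adj v z ∧ G.Adj x z ∧ D x z, ?_⟩
  have nb : ∀ x y z, G.Adj v x → G.Adj v y → G.Adj v z → G.Adj x y → G.Adj y z →
      D x y → D y z → False := by
    intro x y z hx hy hz hxy hyz h1 h2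
    by_cases hxz : x = z
    · subst hxz; exact hanti _ _ hxy.ne h1 h2
    · have : D x z := fun p hp => (h2 p hp).trans (h1 p hp)
      exact hK v x y z hx hy hz hxy hyz ((hD x z hx hz hxz).2 (Or.inl this))
  intro x y hx hy hxy
  constructor
  · rintro ⟨z, hz, hxz, d⟩ ⟨t, ht, hyt, d'⟩
    rcases (hD x y hx hy hxy.ne).1 hxy with h | h
    · exact nb x y t hx hy ht hxy hyt h d'
    · exact nb y x z hy hx hz hxy.symm hxz h d
  · intro H
    rcases (hD x y hx hy hxy.ne).1 hxy with h | h
    · exact ⟨y, hy, hxy, h⟩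
    · exact absurd ⟨x, hx, hxy.symm, h⟩ H

def GoodW {V : Type*} (u v : V) (l : List V) : Prop :=
  ∃ k, l = (List.replicate k [u, v]).flatten

theorem GoodW.append {V : Type*} {u v : V} {l l' : List V} (h : GoodW u v l) (h' : GoodW u v l') :
    GoodW u v (l ++ l') := by
  obtain ⟨k, rfl⟩ := h
  obtain ⟨k', rfl⟩ := h'
  exact ⟨k + k', by rw [List.replicate_add, List.flatten_append]⟩

theorem GoodW.chain {V : Type*} {u v : V} {l : List V} (huv : u ≠ v) (h : GoodW u v l) :
    List.IsChain (· ≠ ·) l := by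
  obtain ⟨k, rfl⟩ := h
  induction k with
  | zero => simp
  | succ k ih =>
    rw [List.replicate_succ, List.flatten_cons]
    cases k with
    | zero => simpa using huv
    | succ k =>
      rw [List.replicate_succ, List.flatten_cons] at ih ⊢
      simp only [List.cons_append, List.nil_append] at ih ⊢
      refine List.IsChain.cons_cons huv (List.IsChain.cons_cons huv.symm ih)

theorem good1 {V : Type*} (u v : V) : GoodW u v [u, v] := ⟨1, by simp⟩
theorem good2 {V : Type*} (u v : V) : GoodW u v [u, v, u, v] := ⟨2, by simp⟩

open Classical in
theorem piece {V : Type*} [DecidableEq V] (L : List V) (hL : L.Nodup) (hm : ∀ v, v ∈ L)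
    (p : V → Prop) (x y : V) (hxy : x ≠ y) (h : ¬ (p x ∧ p y)) :
    ((L.filter fun z => p z).filter fun z => z = x ∨ z = y) =
      (if p x then [x] else []) ++ (if p y then [y] else []) := by
  have one : ∀ t : V, (L.filter fun z => z = t) = [t] := by
    intro t
    have := List.Nodup.filter (fun z => decide (z = t)) hL
    have h2 : ∀ z, z ∈ (L.filter fun z => z = t) ↔ z = t := by
      intro z; simp [hm]
    have h3 : (L.filter fun z => z = t).Perm [t] := by
      rw [List.perm_ext_iff_of_nodup this (by simp)]
      intro z; simp [hm]
    exact List.perm_singleton.1 h3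
  rw [List.filter_filter]
  by_cases hx : p x
  · have hy : ¬ p y := fun hy => h ⟨hx, hy⟩
    simp only [hx, hy, if_true, if_false, List.append_nil]
    rw [← one x]
    apply List.filter_congr
    intro z _
    by_cases hz : z = x
    · subst hz; simp [hx]
    · by_cases hz' : z = y
      · subst hz'; simp [hy, hz]
      · simp [hz, hz']
  · by_cases hy : p y
    · simp only [hx, hy, if_true, if_false, List.nil_append]
      rw [← one y]
      apply List.filter_congr
      intro z _
      by_cases hz : z = y
      · subst hz; simp [hy]
      · by_cases hz' : z = x
        · subst hz'; simp [hx, hz]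
        · simp [hz, hz']
    · simp only [hx, hy, if_false, List.nil_append]
      rw [List.filter_eq_nil_iff]
      intro z _
      by_cases hz : z = y
      · subst hz; simp [hy]
      · by_cases hz' : z = x
        · subst hz'; simp [hx]
        · simp [hz, hz']

open Classical in
/-- concatenation of pieces -/
noncomputable def pcs {V : Type*} (L : List V) (ps : List (V → Prop)) : List V :=
  ps.flatMap fun p => L.filter fun z => p z

open Classical in
theorem pcs_filter {V : Type*} [DecidableEq V] (L : List V) (hL : L.Nodup) (hm : ∀ v, v ∈ L)
    (ps : List (V → Prop)) (x y : V) (hxy : x ≠ y) (h : ∀ p ∈ ps, ¬ (p x ∧ p y)) :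
    ((pcs L ps).filter fun z => z = x ∨ z = y) =
      ps.flatMap fun p => (if p x then [x] else []) ++ (if p y then [y] else []) := by
  unfold pcs
  rw [List.filter_flatMap]
  induction ps with
  | nil => simp
  | cons p ps ih =>
    rw [List.flatMap_cons, List.flatMap_cons, ih (fun q hq => h q (by simp [hq])),
      piece L hL hm p x y hxy (h p (by simp))]

open Classical in
theorem exists_block {V : Type*} [DecidableEq V] (G : SimpleGraph V) (L : List V) (hL : L.Nodup)
    (hm : ∀ v, v ∈ L) (c : V → Fin 3) (hc : ∀ u v, G.Adj u v → c u ≠ c v)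
    (x y : V) (hxy : c x ≤ c y) :
    ∃ l : List V, (∀ u v, G.Adj u v → c u < c v → GoodW u v (l.filter fun z => z = u ∨ z = v)) ∧
      x ∈ l ∧ (x ≠ y → ¬ G.Adj x y → ¬ List.IsChain (· ≠ ·) (l.filter fun z => z = x ∨ z = y)) := by
  have key : ∀ ps : List (V → Prop),
      (∀ p ∈ ps, ∀ u v, p u → p v → c u = c v) →
      (∀ u v, G.Adj u v → c u < c v → GoodW u v
        (ps.flatMap fun p => (if p u then [u] else []) ++ (if p v then [v] else []))) →
      (∃ p ∈ ps, p x) →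
      (x ≠ y → ¬ G.Adj x y → (∀ p ∈ ps, ¬ (p x ∧ p y)) ∧ ¬ List.IsChain (· ≠ ·)
        (ps.flatMap fun p => (if p x then [x] else []) ++ (if p y then [y] else []))) →
      ∃ l : List V, (∀ u v, G.Adj u v → c u < c v → GoodW u v (l.filter fun z => z = u ∨ z = v)) ∧
      x ∈ l ∧ (x ≠ y → ¬ G.Adj x y →
        ¬ List.IsChain (· ≠ ·) (l.filter fun z => z = x ∨ z = y)) := by
    intro ps h1 h2 h3 h4
    refine ⟨pcs L ps, ?_, ?_, ?_⟩
    · intro u v huv hlt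
      rw [pcs_filter L hL hm ps u v huv.ne]
      · exact h2 u v huv hlt
      · intro p hp ⟨a, b⟩
        exact hlt.ne (h1 p hp u v a b)
    · obtain ⟨p, hp, hpx⟩ := h3
      unfold pcs
      rw [List.mem_flatMap]
      exact ⟨p, hp, by simp [hm, hpx]⟩
    · intro hne hna
      rw [pcs_filter L hL hm ps x y hne (h4 hne hna).1]
      exact (h4 hne hna).2
  have tri : ∀ z, c z = 0 ∨ c z = 1 ∨ c z = 2 := by
    intro z; generalize c z = k; revert k; decide
  have lt3 : ∀ u v, c u < c v → (c u = 0 ∧ c v = 1) ∨ (c u = 0 ∧ c v = 2) ∨ (c u = 1 ∧ c v = 2) := by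
    intro u v; generalize c u = k; generalize c v = l; revert k l; decide
  have le3 : (c x = c y) ∨ (c x = 0 ∧ c y = 1) ∨ (c x = 0 ∧ c y = 2) ∨ (c x = 1 ∧ c y = 2) := by
    rcases hxy.eq_or_lt with h | h
    · exact Or.inl h
    · exact Or.inr (lt3 x y h)
  rcases le3 with hE | ⟨hx, hy⟩ | ⟨hx, hy⟩ | ⟨hx, hy⟩
  · -- same colour
    apply key [fun z => c z = 0 ∧ z = x, fun z => c z = 0 ∧ z ≠ x, fun z => c z = 1 ∧ z = x,
      fun z => c z = 1 ∧ z ≠ x, fun z => c z = 2 ∧ z = x, fun z => c z = 2 ∧ z ≠ x,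
      fun z => c z = 0 ∧ z ≠ x, fun z => c z = 0 ∧ z = x, fun z => c z = 1 ∧ z ≠ x,
      fun z => c z = 1 ∧ z = x, fun z => c z = 2 ∧ z ≠ x, fun z => c z = 2 ∧ z = x]
    · simp +contextual
    · intro u v huv hlt
      rcases lt3 u v hlt with ⟨h1, h2⟩ | ⟨h1, h2⟩ | ⟨h1, h2⟩ <;>
        by_cases hu : u = x
      all_goals first
        | (subst hu; have hv := huv.ne'; simp [h1, h2, hv, good2]; done)
        | (by_cases hv : v = x
           · subst hv; simp [h1, h2, hu, good2]
           · simp [h1, h2, hu, hv, good2])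
    · rcases tri x with h | h | h <;> simp [h]
    · intro hne _
      refine ⟨by simp +contextual [hne.symm], ?_⟩
      rcases tri x with h | h | h <;> rw [h] at hE <;> simp [h, ← hE, hne.symm]
  · -- colours 0, 1
    apply key [fun z => c z = 0, fun z => c z = 1, fun z => c z = 2,
      fun z => c z = 0 ∧ z ≠ x, fun z => c z = 1 ∧ ¬ G.Adj x z, fun z => c z = 0 ∧ z = x,
      fun z => c z = 1 ∧ G.Adj x z, fun z => c z = 2]
    · simp +contextual
    · intro u v huv hlt
      rcases lt3 u v hlt with ⟨h1, h2⟩ | ⟨h1, h2⟩ | ⟨h1, h2⟩ <;>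
        by_cases hu : u = x
      · subst hu; simp [h1, h2, huv, good2]
      · by_cases hv : G.Adj x v <;> simp [h1, h2, hu, hv, good2]
      · subst hu; simp [h1, h2, good2]
      · simp [h1, h2, hu, good2]
      · simp [← hu, h1] at hx
      · by_cases hv : G.Adj x u <;> simp [h1, h2, hv, good2]
    · simp [hx]
    · intro hne hna
      simp [hx, hy, hna]
  · -- colours 0, 2
    apply key [fun z => c z = 0, fun z => c z = 1, fun z => c z = 2 ∧ G.Adj x z,
      fun z => c z = 0 ∧ z = x, fun z => c z = 2 ∧ ¬ G.Adj x z, fun z => c z = 0 ∧ z ≠ x,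
      fun z => c z = 1, fun z => c z = 2]
    · simp +contextual
    · intro u v huv hlt
      rcases lt3 u v hlt with ⟨h1, h2⟩ | ⟨h1, h2⟩ | ⟨h1, h2⟩ <;>
        by_cases hu : u = x
      · subst hu; simp [h1, h2, good2]
      · simp [h1, h2, hu, good2]
      · subst hu; simp [h1, h2, huv, good2]
      · by_cases hv : G.Adj x v <;> simp [h1, h2, hu, hv, good2]
      · simp [← hu, h1] at hx
      · by_cases hv : G.Adj x v <;> simp [h1, h2, hv, good2]
    · simp [hx]
    · intro hne hna
      simp [hx, hy, hna]
  · -- colours 1, 2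
    apply key [fun z => c z = 0, fun z => c z = 1, fun z => c z = 2,
      fun z => c z = 0, fun z => c z = 1 ∧ G.Adj y z, fun z => c z = 2 ∧ z = y,
      fun z => c z = 1 ∧ ¬ G.Adj y z, fun z => c z = 2 ∧ z ≠ y]
    · simp +contextual
    · intro u v huv hlt
      rcases lt3 u v hlt with ⟨h1, h2⟩ | ⟨h1, h2⟩ | ⟨h1, h2⟩ <;>
        by_cases hu : v = y
      · simp [← hu, h2] at hy
      · by_cases hv : G.Adj y v <;> simp [h1, h2, hv, good2]
      · subst hu; simp [h1, h2, good2]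
      · simp [h1, h2, hu, good2]
      · subst hu; simp [h1, h2, huv.symm, good2]
      · by_cases hv : G.Adj y u <;> simp [h1, h2, hu, hv, good2]
    · simp [hx]
    · intro hne hna
      have hna' : ¬ G.Adj y x := fun h => hna h.symm
      simp [hx, hy, hna']

theorem wordRep_of_col {V : Type*} [DecidableEq V] [Finite V] (G : SimpleGraph V)
    (h : G.Colorable 3) : WordRepresentable G := by
  obtain ⟨C⟩ := h
  have : Fintype V := Fintype.ofFinite V
  obtain ⟨L, hL, hm⟩ : ∃ L : List V, L.Nodup ∧ ∀ v, v ∈ L :=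
    ⟨(Finset.univ : Finset V).toList, Finset.nodup_toList _, by simp⟩
  let c : V → Fin 3 := fun v => C v
  have hc : ∀ u v, G.Adj u v → c u ≠ c v := fun u v h => C.valid h
  have H := exists_block G L hL hm c hc
  have H' : ∀ q : V × V, ∃ l : List V,
      (∀ u v, G.Adj u v → c u < c v → GoodW u v (l.filter fun z => z = u ∨ z = v)) ∧
      (c q.1 ≤ c q.2 → (q.1 ∈ l ∧ (q.1 ≠ q.2 → ¬ G.Adj q.1 q.2 →
        ¬ List.IsChain (· ≠ ·) (l.filter fun z => z = q.1 ∨ z = q.2)))) := by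
    intro q
    by_cases hq : c q.1 ≤ c q.2
    · obtain ⟨l, h1, h2⟩ := H q.1 q.2 hq
      exact ⟨l, h1, fun _ => h2⟩
    · exact ⟨[], fun u v _ _ => ⟨0, by simp⟩, fun h => absurd h hq⟩
  choose f hf1 hf2 using H'
  have hgood : ∀ (Q : List (V × V)) u v, G.Adj u v → c u < c v →
      GoodW u v ((Q.flatMap f).filter fun z => z = u ∨ z = v) := by
    intro Q u v huv hlt
    induction Q with
    | nil => exact ⟨0, by simp⟩
    | cons q Q ih =>
      rw [List.flatMap_cons, List.filter_append]
      exact (hf1 q u v huv hlt).append ih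
  let Q : List (V × V) := (Finset.univ : Finset (V × V)).toList
  have hQ : ∀ q, q ∈ Q := by simp [Q]
  have hinf : ∀ q, f q <:+: Q.flatMap f := by
    intro q
    obtain ⟨s, t, hst⟩ := List.append_of_mem (hQ q)
    refine ⟨s.flatMap f, t.flatMap f, ?_⟩
    rw [hst]; simp
  have hne : ∀ x y, x ≠ y → ¬ G.Adj x y → c x ≤ c y → ¬ Alternates (Q.flatMap f) x y := by
    intro x y hxy hna hle hA
    refine (hf2 (x, y) hle).2 hxy hna ?_
    unfold Alternates List.Chain' at hA
    exact hA.infix ((hinf (x, y)).filter _)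
  have hsymm : ∀ w : List V, ∀ x y, Alternates w x y → Alternates w y x := by
    intro w x y h
    unfold Alternates at *
    rwa [filt_comm]
  refine ⟨Q.flatMap f, ?_, ?_⟩
  · intro v
    exact (hinf (v, v)).subset (hf2 (v, v) le_rfl).1
  · intro x y hxy
    constructor
    · intro ha
      rcases lt_or_gt_of_ne (hc x y ha) with h | h
      · exact (hgood Q x y ha h).chain hxy
      · exact hsymm _ _ _ ((hgood Q y x ha.symm h).chain hxy.symm)
    · intro hA
      by_contra hna
      rcases le_total (c x) (c y) with h | h
      · exact hne x y hxy hna h hA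
      · exact hne y x hxy.symm (fun h => hna h.symm) h (hsymm _ _ _ hA)

/-- edge relation on integer points -/
def Rd (a b : ℕ) (diag : ℕ → ℕ → Bool) (dom : Bool) (u v : ℕ × ℕ) : Prop :=
    (v.1 = u.1 + 1 ∧ v.2 = u.2) ∨
    (v.1 = u.1 ∧ v.2 = u.2 + 1 ∧ ¬(u.1 = a + 1 ∧ u.2 = b)) ∨
    (¬((u.1 = a ∨ u.1 = a + 1) ∧ u.2 = b) ∧ diag u.1 u.2 = true ∧
      v.1 = u.1 + 1 ∧ v.2 = u.2 + 1) ∨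
    (∃ i j, ¬((i = a ∨ i = a + 1) ∧ j = b) ∧ diag i j = false ∧
      u.1 = i + 1 ∧ u.2 = j ∧ v.1 = i ∧ v.2 = j + 1) ∨
    (dom = true ∧
      ((u = (a, b) ∧ v = (a + 2, b + 1)) ∨
       (u = (a, b) ∧ v = (a + 1, b + 1)) ∨
       (u = (a + 1, b) ∧ v = (a + 2, b + 1)))) ∨
    (dom = false ∧
      ((u = (a + 1, b) ∧ v = (a, b + 1)) ∨
       (u = (a + 2, b) ∧ v = (a + 1, b + 1)) ∨
       (u = (a + 2, b) ∧ v = (a, b + 1))))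

def Ad (a b : ℕ) (diag : ℕ → ℕ → Bool) (dom : Bool) (u v : ℕ × ℕ) : Prop :=
  Rd a b diag dom u v ∨ Rd a b diag dom v u

section
variable {a b : ℕ} {diag : ℕ → ℕ → Bool} {dom : Bool}

theorem Ad.symm {p q : ℕ × ℕ} (h : Ad a b diag dom p q) : Ad a b diag dom q p := Or.symm h

theorem Rd_ne {p q : ℕ × ℕ} (h : Rd a b diag dom p q) : p ≠ q := by
  rintro rfl
  obtain ⟨x, y⟩ := p
  simp [Rd] at h
  omega

theorem Ad_ne {p q : ℕ × ℕ} (h : Ad a b diag dom p q) : p ≠ q := by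
  rcases h with h | h
  · exact Rd_ne h
  · exact (Rd_ne h).symm

theorem adj_iff {m n : ℕ} (u v : GridV m n) :
    (dominoTriangulationH m n a b diag dom).Adj u v ↔ Ad a b diag dom u.1 v.1 := by
  unfold dominoTriangulationH
  rw [SimpleGraph.fromRel_adj]
  constructor
  · intro h; exact h.2
  · intro h; exact ⟨fun e => Ad_ne h (by rw [e]), h⟩

theorem Ad_h (i j : ℕ) : Ad a b diag dom (i, j) (i + 1, j) := by
  left; left; simp
theorem Ad_v (i j : ℕ) (h : ¬ (i = a + 1 ∧ j = b)) : Ad a b diag dom (i, j) (i, j + 1) := by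
  left; right; left; simpa using h
theorem Ad_d1 (i j : ℕ) (h : ¬ ((i = a ∨ i = a + 1) ∧ j = b)) (hd : diag i j = true) :
    Ad a b diag dom (i, j) (i + 1, j + 1) := by
  left; right; right; left; exact ⟨h, hd, rfl, rfl⟩
theorem Ad_d2 (i j : ℕ) (h : ¬ ((i = a ∨ i = a + 1) ∧ j = b)) (hd : diag i j = false) :
    Ad a b diag dom (i + 1, j) (i, j + 1) := by
  left; right; right; right; left; exact ⟨i, j, h, hd, rfl, rfl, rfl, rfl⟩

def LongP (a b : ℕ) (dom : Bool) (p q : ℕ × ℕ) : Prop :=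
  (dom = true ∧ p = (a, b) ∧ q = (a + 2, b + 1)) ∨ (dom = false ∧ p = (a + 2, b) ∧ q = (a, b + 1))

def NearP (p q : ℕ × ℕ) : Prop :=
  p.1 ≤ q.1 + 1 ∧ q.1 ≤ p.1 + 1 ∧ p.2 ≤ q.2 + 1 ∧ q.2 ≤ p.2 + 1

theorem Rd_near {p q : ℕ × ℕ} (h : Rd a b diag dom p q) : NearP p q ∨ LongP a b dom p q := by
  obtain ⟨x, y⟩ := p
  obtain ⟨z, t⟩ := q
  simp only [Rd, NearP, LongP, Prod.mk.injEq] at *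
  rcases h with h | h | h | ⟨i, j, h⟩ | ⟨h0, h⟩ | ⟨h0, h⟩
  · left; omega
  · left; omega
  · left; omega
  · left; omega
  · rcases h with h | h | h
    · right; left; exact ⟨h0, h⟩
    · left; omega
    · left; omega
  · rcases h with h | h | h
    · left; omega
    · left; omega
    · right; right; exact ⟨h0, h⟩

theorem Ad_near {p q : ℕ × ℕ} (h : Ad a b diag dom p q) :
    NearP p q ∨ LongP a b dom p q ∨ LongP a b dom q p := by
  rcases h with h | h
  · rcases Rd_near h with h | h
    · exact Or.inl h
    · exact Or.inr (Or.inl h)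
  · rcases Rd_near h with h | h
    · left; unfold NearP at *; omega
    · exact Or.inr (Or.inr h)

theorem long_common {p q r : ℕ × ℕ} (h : LongP a b dom p q) (h1 : Ad a b diag dom r p)
    (h2 : Ad a b diag dom r q) : r = (a + 1, b) ∨ r = (a + 1, b + 1) := by
  have n1 := Ad_ne h1
  have n2 := Ad_ne h2
  have e1 := Ad_near h1
  have e2 := Ad_near h2
  obtain ⟨x, y⟩ := r
  rcases h with ⟨h0, rfl, rfl⟩ | ⟨h0, rfl, rfl⟩ <;> subst h0 <;>
    simp [NearP, LongP] at * <;> omega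

theorem not_mid : ¬ Ad a b diag dom (a + 1, b) (a + 1, b + 1) := by
  simp [Ad, Rd]
  omega

theorem noLong {v x y z : ℕ × ℕ} (hl : LongP a b dom v x)
    (hvy : Ad a b diag dom v y) (hvz : Ad a b diag dom v z)
    (hxy : Ad a b diag dom x y) (hxz : Ad a b diag dom x z) (hyz : Ad a b diag dom y z) : False := by
  have n := Ad_ne hyz
  rcases long_common hl hvy.symm hxy.symm with h | h <;>
  rcases long_common hl hvz.symm hxz.symm with h' | h'
  · exact n (h.trans h'.symm)
  · rw [h, h'] at hyz; exact not_mid hyz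
  · rw [h, h'] at hyz; exact not_mid hyz.symm
  · exact n (h.trans h'.symm)

theorem noCell {i j : ℕ} (h1 : Ad a b diag dom (i, j) (i + 1, j + 1))
    (h2 : Ad a b diag dom (i + 1, j) (i, j + 1)) (h3 : Ad a b diag dom (i, j) (i, j + 1))
    (h4 : Ad a b diag dom (i + 1, j) (i + 1, j + 1)) : False := by
  by_cases hc : (i = a ∨ i = a + 1) ∧ j = b
  · obtain ⟨rfl | rfl, rfl⟩ := hc
    · exact not_mid h4
    · exact not_mid h3
  · have e1 : diag i j = true := by
      rcases h1 with h1 | h1 <;> simp [Rd] at h1 <;> grind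
    have e2 : diag i j = false := by
      rcases h2 with h1 | h1 <;> simp [Rd] at h1 <;> grind
    simp [e1] at e2

theorem noK4 {v x y z : ℕ × ℕ} (hvx : Ad a b diag dom v x)
    (hvy : Ad a b diag dom v y) (hvz : Ad a b diag dom v z)
    (hxy : Ad a b diag dom x y) (hyz : Ad a b diag dom y z) (hxz : Ad a b diag dom x z) : False := by
  have f1 : NearP v x := by
    rcases Ad_near hvx with h | h | h
    · exact h
    · exact (noLong h hvy hvz hxy hxz hyz).elim
    · exact (noLong h hxy hxz hvy hvz hyz).elim
  have f2 : NearP v y := by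
    rcases Ad_near hvy with h | h | h
    · exact h
    · exact (noLong h hvx hvz hxy.symm hyz hxz).elim
    · exact (noLong h hxy.symm hyz hvx hvz hxz).elim
  have f3 : NearP v z := by
    rcases Ad_near hvz with h | h | h
    · exact h
    · exact (noLong h hvx hvy hxz.symm hyz.symm hxy).elim
    · exact (noLong h hxz.symm hyz.symm hvx hvy hxy).elim
  have f4 : NearP x y := by
    rcases Ad_near hxy with h | h | h
    · exact h
    · exact (noLong h hvx.symm hxz hvy.symm hyz hvz).elim
    · exact (noLong h hvy.symm hyz hvx.symm hxz hvz).elim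
  have f5 : NearP y z := by
    rcases Ad_near hyz with h | h | h
    · exact h
    · exact (noLong h hvy.symm hxy.symm hvz.symm hxz.symm hvx).elim
    · exact (noLong h hvz.symm hxz.symm hvy.symm hxy.symm hvx).elim
  have f6 : NearP x z := by
    rcases Ad_near hxz with h | h | h
    · exact h
    · exact (noLong h hvx.symm hxy hvz.symm hyz.symm hvy).elim
    · exact (noLong h hvz.symm hyz.symm hvx.symm hxy hvy).elim
  let S : Finset (ℕ × ℕ) := {v, x, y, z}
  have hS : S.card = 4 := by
    have := Ad_ne hvx; have := Ad_ne hvy; have := Ad_ne hvz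
    have := Ad_ne hxy; have := Ad_ne hyz; have := Ad_ne hxz
    simp [S, *]
  have hcl : ∀ p ∈ S, ∀ q ∈ S, p ≠ q → Ad a b diag dom p q := by
    intro p hp q hq hpq
    simp only [S, Finset.mem_insert, Finset.mem_singleton] at hp hq
    rcases hp with rfl | rfl | rfl | rfl <;> rcases hq with rfl | rfl | rfl | rfl <;>
      first
      | exact absurd rfl hpq
      | assumption
      | (apply Ad.symm; assumption)
  obtain ⟨i, hi⟩ : ∃ i, ∀ p ∈ S, p.1 = i ∨ p.1 = i + 1 := by
    refine ⟨min (min v.1 x.1) (min y.1 z.1), ?_⟩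
    simp only [S, Finset.mem_insert, Finset.mem_singleton]
    unfold NearP at *
    rintro p (rfl | rfl | rfl | rfl) <;> omega
  obtain ⟨j, hj⟩ : ∃ j, ∀ p ∈ S, p.2 = j ∨ p.2 = j + 1 := by
    refine ⟨min (min v.2 x.2) (min y.2 z.2), ?_⟩
    simp only [S, Finset.mem_insert, Finset.mem_singleton]
    unfold NearP at *
    rintro p (rfl | rfl | rfl | rfl) <;> omega
  have hsub : S ⊆ ({i, i + 1} : Finset ℕ) ×ˢ ({j, j + 1} : Finset ℕ) := by
    intro p hp
    have := hi p hp
    have := hj p hp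
    simp [Finset.mem_product, *]
  have heq := Finset.eq_of_subset_of_card_le hsub (by rw [hS, Finset.card_product]; simp)
  have c1 : (i, j) ∈ S := by rw [heq]; simp
  have c2 : (i + 1, j) ∈ S := by rw [heq]; simp
  have c3 : (i, j + 1) ∈ S := by rw [heq]; simp
  have c4 : (i + 1, j + 1) ∈ S := by rw [heq]; simp
  exact noCell (hcl _ c1 _ c4 (by simp)) (hcl _ c2 _ c3 (by simp)) (hcl _ c1 _ c3 (by simp))
    (hcl _ c2 _ c4 (by simp))

end

/-- effective diagonal directions -/
def tt (a b : ℕ) (diag : ℕ → ℕ → Bool) (i j : ℕ) : Bool :=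
  if i = a ∨ i = a + 1 then
    (if j < b then diag i j else if j = b then decide (i = a + 1) else !diag i j)
  else diag i j

theorem iff2 {p q c : Prop} (h1 : p ↔ ¬ c) (h2 : q ↔ ¬ c) : p ↔ q := h1.trans h2.symm

set_option maxHeartbeats 2000000 in
theorem tt_final {a b i j : ℕ} {diag : ℕ → ℕ → Bool} {W E S N : Prop}
    (hNE : ¬ ((i + 1 = a ∨ i + 1 = a + 1) ∧ j + 1 = b) →
      (diag (i + 1) (j + 1) = true ∧ (E ↔ N)) ∨ (diag (i + 1) (j + 1) = false ∧ (E ↔ ¬ N)))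
    (hNW : ¬ ((i = a ∨ i = a + 1) ∧ j + 1 = b) →
      (diag i (j + 1) = false ∧ (W ↔ N)) ∨ (diag i (j + 1) = true ∧ (W ↔ ¬ N)))
    (hSW : ¬ ((i = a ∨ i = a + 1) ∧ j = b) →
      (diag i j = true ∧ (W ↔ S)) ∨ (diag i j = false ∧ (W ↔ ¬ S)))
    (hSE : ¬ ((i + 1 = a ∨ i + 1 = a + 1) ∧ j = b) →
      (diag (i + 1) j = false ∧ (E ↔ S)) ∨ (diag (i + 1) j = true ∧ (E ↔ ¬ S)))
    (d1 : i + 1 = a → j + 1 = b → (E ↔ ¬ N)) (d2 : i = a + 1 → j + 1 = b → (W ↔ ¬ N))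
    (d3 : i = a + 1 → j = b → (W ↔ ¬ S)) (d4 : i + 1 = a → j = b → (E ↔ ¬ S))
    (d5 : i = a → j + 1 = b → (W ↔ E)) (d6 : i = a → j = b → (W ↔ E)) :
    (tt a b diag i j ^^ tt a b diag (i + 1) j ^^ tt a b diag i (j + 1) ^^
      tt a b diag (i + 1) (j + 1)) = false := by
  have hjc : j + 1 < b ∨ j + 1 = b ∨ j = b ∨ b < j := by omega
  have hic : (i + 1 ≠ a ∧ i ≠ a ∧ i ≠ a + 1) ∨ i + 1 = a ∨ i = a ∨ i = a + 1 := by omega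
  unfold tt
  generalize diag i j = p1 at *
  generalize diag (i + 1) j = p2 at *
  generalize diag i (j + 1) = p3 at *
  generalize diag (i + 1) (j + 1) = p4 at *
  rcases hic with ⟨x1, x2, x3⟩ | x | x | x
  · have x4 : i + 1 ≠ a + 1 := by omega
    simp only [x1, x2, x3, x4, false_or, false_and, not_false_eq_true, forall_const, if_false] at *
    grind
  all_goals
    rcases hjc with y | y | y | y
  all_goals grind

theorem interior_tt {a b m n : ℕ} {diag : ℕ → ℕ → Bool} {dom : Bool} (ha : a + 2 ≤ m) (hb : b + 1 ≤ n)
    (hw : WordRepresentable (dominoTriangulationH m n a b diag dom)) (i j : ℕ)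
    (hi : i + 2 ≤ m) (hj : j + 2 ≤ n) :
    (tt a b diag i j ^^ tt a b diag (i + 1) j ^^ tt a b diag i (j + 1) ^^
      tt a b diag (i + 1) (j + 1)) = false := by
  obtain ⟨τ', h'⟩ := nbhd_bip _ hw (by
    intro v x y z
    simp only [adj_iff]
    exact noK4) ⟨(i + 1, j + 1), by simp; omega⟩
  obtain ⟨τ, hτ⟩ : ∃ τ : ℕ × ℕ → Prop, ∀ p q : ℕ × ℕ, p.1 ≤ m → p.2 ≤ n → q.1 ≤ m → q.2 ≤ n →
      Ad a b diag dom (i + 1, j + 1) p → Ad a b diag dom (i + 1, j + 1) q →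
      Ad a b diag dom p q → (τ p ↔ ¬ τ q) := by
    refine ⟨fun p => ∃ h : p.1 ≤ m ∧ p.2 ≤ n, τ' ⟨p, h⟩, ?_⟩
    intro p q h1 h2 h3 h4 h5 h6 h7
    have := h' ⟨p, h1, h2⟩ ⟨q, h3, h4⟩
    simp only [adj_iff] at this
    have := this h5 h6 h7
    simp only [h1, h2, h3, h4, and_self, exists_true_left]
    exact this
  clear h' τ'
  have hNE : ¬ ((i + 1 = a ∨ i + 1 = a + 1) ∧ j + 1 = b) →
      (diag (i + 1) (j + 1) = true ∧ (τ (i + 2, j + 1) ↔ τ (i + 1, j + 2))) ∨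
      (diag (i + 1) (j + 1) = false ∧ (τ (i + 2, j + 1) ↔ ¬ τ (i + 1, j + 2))) := by
    intro hc
    have vE : Ad a b diag dom (i + 1, j + 1) (i + 2, j + 1) := Ad_h _ _
    have vN : Ad a b diag dom (i + 1, j + 1) (i + 1, j + 2) := Ad_v _ _ (by omega)
    cases hd : diag (i + 1) (j + 1)
    · have := hτ _ _ (by dsimp only; omega) (by dsimp only; omega) (by dsimp only; omega) (by dsimp only; omega) vE vN
        (Ad_d2 _ _ hc hd)
      exact Or.inr ⟨rfl, this⟩
    · have vc : Ad a b diag dom (i + 1, j + 1) (i + 2, j + 2) := Ad_d1 _ _ hc hd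
      have h1 := hτ _ _ (by dsimp only; omega) (by dsimp only; omega) (by dsimp only; omega) (by dsimp only; omega) vE vc
        (Ad_v _ _ (by omega))
      have h2 := hτ _ _ (by dsimp only; omega) (by dsimp only; omega) (by dsimp only; omega) (by dsimp only; omega) vN vc
        (Ad_h _ _)
      exact Or.inl ⟨rfl, iff2 h1 h2⟩
  have hNW : ¬ ((i = a ∨ i = a + 1) ∧ j + 1 = b) →
      (diag i (j + 1) = false ∧ (τ (i, j + 1) ↔ τ (i + 1, j + 2))) ∨
      (diag i (j + 1) = true ∧ (τ (i, j + 1) ↔ ¬ τ (i + 1, j + 2))) := by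
    intro hc
    have vE : Ad a b diag dom (i + 1, j + 1) (i, j + 1) := (Ad_h _ _).symm
    have vN : Ad a b diag dom (i + 1, j + 1) (i + 1, j + 2) := Ad_v _ _ (by omega)
    cases hd : diag i (j + 1)
    · have vc : Ad a b diag dom (i + 1, j + 1) (i, j + 2) := Ad_d2 _ _ hc hd
      have h1 := hτ _ _ (by dsimp only; omega) (by dsimp only; omega) (by dsimp only; omega) (by dsimp only; omega) vE vc
        (Ad_v _ _ (by omega))
      have h2 := hτ _ _ (by dsimp only; omega) (by dsimp only; omega) (by dsimp only; omega) (by dsimp only; omega) vN vc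
        (Ad_h _ _).symm
      exact Or.inl ⟨rfl, iff2 h1 h2⟩
    · have := hτ _ _ (by dsimp only; omega) (by dsimp only; omega) (by dsimp only; omega) (by dsimp only; omega) vE vN
        (Ad_d1 _ _ hc hd)
      exact Or.inr ⟨rfl, this⟩
  have hSW : ¬ ((i = a ∨ i = a + 1) ∧ j = b) →
      (diag i j = true ∧ (τ (i, j + 1) ↔ τ (i + 1, j))) ∨
      (diag i j = false ∧ (τ (i, j + 1) ↔ ¬ τ (i + 1, j))) := by
    intro hc
    have vE : Ad a b diag dom (i + 1, j + 1) (i, j + 1) := (Ad_h _ _).symm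
    have vN : Ad a b diag dom (i + 1, j + 1) (i + 1, j) := (Ad_v _ _ (by omega)).symm
    cases hd : diag i j
    · have := hτ _ _ (by dsimp only; omega) (by dsimp only; omega) (by dsimp only; omega) (by dsimp only; omega) vE vN
        (Ad_d2 _ _ hc hd).symm
      exact Or.inr ⟨rfl, this⟩
    · have vc : Ad a b diag dom (i + 1, j + 1) (i, j) := (Ad_d1 _ _ hc hd).symm
      have h1 := hτ _ _ (by dsimp only; omega) (by dsimp only; omega) (by dsimp only; omega) (by dsimp only; omega) vE vc
        (Ad_v _ _ (by omega)).symm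
      have h2 := hτ _ _ (by dsimp only; omega) (by dsimp only; omega) (by dsimp only; omega) (by dsimp only; omega) vN vc
        (Ad_h _ _).symm
      exact Or.inl ⟨rfl, iff2 h1 h2⟩
  have hSE : ¬ ((i + 1 = a ∨ i + 1 = a + 1) ∧ j = b) →
      (diag (i + 1) j = false ∧ (τ (i + 2, j + 1) ↔ τ (i + 1, j))) ∨
      (diag (i + 1) j = true ∧ (τ (i + 2, j + 1) ↔ ¬ τ (i + 1, j))) := by
    intro hc
    have vE : Ad a b diag dom (i + 1, j + 1) (i + 2, j + 1) := Ad_h _ _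
    have vN : Ad a b diag dom (i + 1, j + 1) (i + 1, j) := (Ad_v _ _ (by omega)).symm
    cases hd : diag (i + 1) j
    · have vc : Ad a b diag dom (i + 1, j + 1) (i + 2, j) := (Ad_d2 _ _ hc hd).symm
      have h1 := hτ _ _ (by dsimp only; omega) (by dsimp only; omega) (by dsimp only; omega) (by dsimp only; omega) vE vc
        (Ad_v _ _ (by omega)).symm
      have h2 := hτ _ _ (by dsimp only; omega) (by dsimp only; omega) (by dsimp only; omega) (by dsimp only; omega) vN vc
        (Ad_h _ _)
      exact Or.inl ⟨rfl, iff2 h1 h2⟩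
    · have := hτ _ _ (by dsimp only; omega) (by dsimp only; omega) (by dsimp only; omega) (by dsimp only; omega) vE vN
        (Ad_d1 _ _ hc hd).symm
      exact Or.inr ⟨rfl, this⟩
  have t1 : dom = true → Ad a b diag dom (a, b) (a + 2, b + 1) ∧
      Ad a b diag dom (a, b) (a + 1, b + 1) ∧ Ad a b diag dom (a + 1, b) (a + 2, b + 1) := by
    rintro rfl; simp [Ad, Rd]
  have t2 : dom = false → Ad a b diag dom (a + 1, b) (a, b + 1) ∧
      Ad a b diag dom (a + 2, b) (a + 1, b + 1) ∧ Ad a b diag dom (a + 2, b) (a, b + 1) := by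
    rintro rfl; simp [Ad, Rd]
  have v1 : Ad a b diag dom (a, b) (a, b + 1) := Ad_v _ _ (by omega)
  have v2 : Ad a b diag dom (a + 2, b) (a + 2, b + 1) := Ad_v _ _ (by omega)
  have g1 : Ad a b diag dom (a, b) (a + 1, b) := Ad_h _ _
  have g2 : Ad a b diag dom (a + 1, b) (a + 2, b) := Ad_h _ _
  have g3 : Ad a b diag dom (a, b + 1) (a + 1, b + 1) := Ad_h _ _
  have g4 : Ad a b diag dom (a + 1, b + 1) (a + 2, b + 1) := Ad_h _ _
  -- specialised bipartiteness
  have hD : ∀ v p q : ℕ × ℕ, v = (i + 1, j + 1) → p.1 ≤ m → p.2 ≤ n → q.1 ≤ m → q.2 ≤ n →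
      Ad a b diag dom v p → Ad a b diag dom v q → Ad a b diag dom p q → (τ p ↔ ¬ τ q) := by
    rintro v p q rfl; exact hτ p q
  have d1 : i + 1 = a → j + 1 = b → (τ (i + 2, j + 1) ↔ ¬ τ (i + 1, j + 2)) := by
    rintro rfl rfl
    cases hdom : dom
    · obtain ⟨k1, k2, k3⟩ := t2 hdom
      exact hD _ _ _ rfl (by dsimp only; omega) (by dsimp only; omega) (by dsimp only; omega) (by dsimp only; omega) g1 v1 k1
    · obtain ⟨k1, k2, k3⟩ := t1 hdom
      have e1 := hD _ _ _ rfl (by dsimp only; omega) (by dsimp only; omega) (by dsimp only; omega) (by dsimp only; omega) g1 k1 k3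
      have e2 := hD _ _ _ rfl (by dsimp only; omega) (by dsimp only; omega) (by dsimp only; omega) (by dsimp only; omega) k2 k1 g4
      have e3 := hD _ _ _ rfl (by dsimp only; omega) (by dsimp only; omega) (by dsimp only; omega) (by dsimp only; omega) v1 k2 g3
      grind only
  have d2 : i = a + 1 → j + 1 = b → (τ (i, j + 1) ↔ ¬ τ (i + 1, j + 2)) := by
    rintro rfl rfl
    cases hdom : dom
    · obtain ⟨k1, k2, k3⟩ := t2 hdom
      have e1 := hD _ _ _ rfl (by dsimp only; omega) (by dsimp only; omega) (by dsimp only; omega) (by dsimp only; omega) g2.symm k3 k1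
      have e2 := hD _ _ _ rfl (by dsimp only; omega) (by dsimp only; omega) (by dsimp only; omega) (by dsimp only; omega) k3 k2 g3
      have e3 := hD _ _ _ rfl (by dsimp only; omega) (by dsimp only; omega) (by dsimp only; omega) (by dsimp only; omega) k2 v2 g4
      grind only
    · obtain ⟨k1, k2, k3⟩ := t1 hdom
      exact hD _ _ _ rfl (by dsimp only; omega) (by dsimp only; omega) (by dsimp only; omega) (by dsimp only; omega) g2.symm v2 k3
  have d3 : i = a + 1 → j = b → (τ (i, j + 1) ↔ ¬ τ (i + 1, j)) := by
    rintro rfl rfl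
    cases hdom : dom
    · obtain ⟨k1, k2, k3⟩ := t2 hdom
      exact hD _ _ _ rfl (by dsimp only; omega) (by dsimp only; omega) (by dsimp only; omega) (by dsimp only; omega) g4.symm v2.symm k2.symm
    · obtain ⟨k1, k2, k3⟩ := t1 hdom
      have e1 := hD _ _ _ rfl (by dsimp only; omega) (by dsimp only; omega) (by dsimp only; omega) (by dsimp only; omega) g4.symm k1.symm k2.symm
      have e2 := hD _ _ _ rfl (by dsimp only; omega) (by dsimp only; omega) (by dsimp only; omega) (by dsimp only; omega) k1.symm k3.symm g1
      have e3 := hD _ _ _ rfl (by dsimp only; omega) (by dsimp only; omega) (by dsimp only; omega) (by dsimp only; omega) k3.symm v2.symm g2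
      grind only
  have d4 : i + 1 = a → j = b → (τ (i + 2, j + 1) ↔ ¬ τ (i + 1, j)) := by
    rintro rfl rfl
    cases hdom : dom
    · obtain ⟨k1, k2, k3⟩ := t2 hdom
      have e1 := hD _ _ _ rfl (by dsimp only; omega) (by dsimp only; omega) (by dsimp only; omega) (by dsimp only; omega) g3 k3.symm k2.symm
      have e2 := hD _ _ _ rfl (by dsimp only; omega) (by dsimp only; omega) (by dsimp only; omega) (by dsimp only; omega) k3.symm k1.symm g2.symm
      have e3 := hD _ _ _ rfl (by dsimp only; omega) (by dsimp only; omega) (by dsimp only; omega) (by dsimp only; omega) k1.symm v1.symm g1.symm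
      grind only
    · obtain ⟨k1, k2, k3⟩ := t1 hdom
      exact hD _ _ _ rfl (by dsimp only; omega) (by dsimp only; omega) (by dsimp only; omega) (by dsimp only; omega) g3 v1.symm k2.symm
  have d5 : i = a → j + 1 = b → (τ (i, j + 1) ↔ τ (i + 2, j + 1)) := by
    rintro rfl rfl
    cases hdom : dom
    · obtain ⟨k1, k2, k3⟩ := t2 hdom
      have e1 := hD _ _ _ rfl (by dsimp only; omega) (by dsimp only; omega) (by dsimp only; omega) (by dsimp only; omega) g1.symm k1 v1
      have e2 := hD _ _ _ rfl (by dsimp only; omega) (by dsimp only; omega) (by dsimp only; omega) (by dsimp only; omega) g2 k1 k3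
      exact iff2 e1 e2
    · obtain ⟨k1, k2, k3⟩ := t1 hdom
      have e1 := hD _ _ _ rfl (by dsimp only; omega) (by dsimp only; omega) (by dsimp only; omega) (by dsimp only; omega) g1.symm k3 k1
      have e2 := hD _ _ _ rfl (by dsimp only; omega) (by dsimp only; omega) (by dsimp only; omega) (by dsimp only; omega) g2 k3 v2
      exact iff2 e1 e2
  have d6 : i = a → j = b → (τ (i, j + 1) ↔ τ (i + 2, j + 1)) := by
    rintro rfl rfl
    cases hdom : dom
    · obtain ⟨k1, k2, k3⟩ := t2 hdom
      have e1 := hD _ _ _ rfl (by dsimp only; omega) (by dsimp only; omega) (by dsimp only; omega) (by dsimp only; omega) g3.symm k2.symm k3.symm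
      have e2 := hD _ _ _ rfl (by dsimp only; omega) (by dsimp only; omega) (by dsimp only; omega) (by dsimp only; omega) g4 k2.symm v2.symm
      exact iff2 e1 e2
    · obtain ⟨k1, k2, k3⟩ := t1 hdom
      have e1 := hD _ _ _ rfl (by dsimp only; omega) (by dsimp only; omega) (by dsimp only; omega) (by dsimp only; omega) g3.symm k2.symm v1.symm
      have e2 := hD _ _ _ rfl (by dsimp only; omega) (by dsimp only; omega) (by dsimp only; omega) (by dsimp only; omega) g4 k2.symm k1.symm
      exact iff2 e1 e2
  clear hD hτ t1 t2 v1 v2 g1 g2 g3 g4 hw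
  exact tt_final hNE hNW hSW hSE d1 d2 d3 d4 d5 d6

theorem rank_one {m n : ℕ} (t : ℕ → ℕ → Bool)
    (h : ∀ i j, i + 2 ≤ m → j + 2 ≤ n →
      (t i j ^^ t (i + 1) j ^^ t i (j + 1) ^^ t (i + 1) (j + 1)) = false) :
    ∃ x y : ℕ → Bool, ∀ i j, i < m → j < n → t i j = (x i == y j) := by
  refine ⟨fun i => t i 0, fun j => !(t 0 j ^^ t 0 0), ?_⟩
  have h1 : ∀ j, j + 2 ≤ n → ∀ i, i < m → (t i j ^^ t i (j + 1)) = (t 0 j ^^ t 0 (j + 1)) := by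
    intro j hj i
    induction i with
    | zero => simp
    | succ i ih =>
      intro hi
      have a1 := ih (by omega)
      have a2 := h i j (by omega) hj
      revert a1 a2
      generalize t i j = p1; generalize t (i + 1) j = p2; generalize t i (j + 1) = p3
      generalize t (i + 1) (j + 1) = p4; generalize t 0 j = p5; generalize t 0 (j + 1) = p6
      revert p1 p2 p3 p4 p5 p6; decide
  intro i j hi
  induction j with
  | zero => intro _; simp
  | succ j ih =>
    intro hj
    have a1 := ih (by omega)
    have a2 := h1 j (by omega) i hi
    revert a1 a2
    simp only
    generalize t i j = p1; generalize t i (j + 1) = p3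
    generalize t i 0 = p4; generalize t 0 j = p5; generalize t 0 (j + 1) = p6
    generalize t 0 0 = p7
    revert p1 p3 p4 p5 p6 p7; decide

def eps (x : Bool) : ZMod 3 := if x then 1 else -1

def psum (x : ℕ → Bool) : ℕ → ZMod 3
  | 0 => 0
  | k + 1 => psum x k + eps (x k)

def colr (a b : ℕ) (x y : ℕ → Bool) (p : ℕ × ℕ) : ZMod 3 :=
  psum x p.1 + psum y p.2 + if p.1 = a + 1 ∧ b < p.2 then eps (x a) else 0

theorem colr_ne {a b m n : ℕ} {diag : ℕ → ℕ → Bool} {dom : Bool} (ha : a + 2 ≤ m) (hb : b + 1 ≤ n)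
    (x y : ℕ → Bool) (h : ∀ i j, i < m → j < n → tt a b diag i j = (x i == y j))
    (p q : ℕ × ℕ) (hp1 : p.1 ≤ m) (hp2 : p.2 ≤ n) (hq1 : q.1 ≤ m) (hq2 : q.2 ≤ n)
    (hR : Rd a b diag dom p q) : colr a b x y p ≠ colr a b x y q := by
  have c1 := h a b (by omega) (by omega)
  have c2 := h (a + 1) b (by omega) (by omega)
  simp [tt] at c1 c2
  have key1 : ∀ (s t : ZMod 3) (u : Bool), s + t ≠ s + eps u + t := by decide
  obtain ⟨i, j⟩ := p
  obtain ⟨k, l⟩ := q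
  simp only [Rd, Prod.mk.injEq] at hR
  simp only at hp1 hp2 hq1 hq2
  rcases hR with ⟨rfl, rfl⟩ | ⟨rfl, rfl, hR⟩ | ⟨hR, hd, rfl, rfl⟩ | ⟨i', j', hR, hd, rfl, rfl, rfl, rfl⟩ | ⟨h0, hR⟩ | ⟨h0, hR⟩
  · by_cases hj : b < l
    · by_cases hi : i = a
      · subst hi
        simp only [colr, psum, hj]
        simp
        generalize psum x i = s; generalize psum y l = t; generalize x i = u
        revert s t u; decide
      · by_cases hi' : i = a + 1
        · subst hi'
          simp only [colr, psum, hj]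
          simp
          revert c1 c2
          generalize psum x a = s; generalize psum y l = t; generalize x a = u
          generalize x (a + 1) = v; generalize y b = w
          revert s t u v w; decide
        · simp only [colr, psum, hj, hi, hi']
          simp [hi]
          generalize x i = u
          revert u; decide
    · simp only [colr, psum, hj]
      simp
      generalize x i = u
      revert u; decide
  · have : (k = a + 1 ∧ b < j) ↔ (k = a + 1 ∧ b < j + 1) := by omega
    simp only [colr, psum, this]
    simp
    generalize y j = u
    revert u; decide
  · have e := h i j (by omega) (by omega)
    by_cases hi : i = a
    · subst hi
      rcases lt_trichotomy j b with hj | hj | hj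
      · have z1 : ¬ b < j := by omega
        have z2 : ¬ b < j + 1 := by omega
        simp [tt, hj, hd] at e
        simp [colr, psum, z1, z2]
        revert e
        generalize psum x i = s; generalize psum y j = t; generalize x i = u; generalize y j = v
        revert s t u v; decide
      · omega
      · have z2 : b < j + 1 := by omega
        have z3 : ¬ j < b := by omega
        have z4 : ¬ j = b := by omega
        simp [tt, z3, z4, hd] at e
        simp [colr, psum, hj, z2]
        revert e
        generalize psum x i = s; generalize psum y j = t; generalize x i = u; generalize y j = v
        revert s t u v; decide
    · by_cases hi' : i = a + 1
      · subst hi'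
        rcases lt_trichotomy j b with hj | hj | hj
        · have z1 : ¬ b < j := by omega
          have z2 : ¬ b < j + 1 := by omega
          simp [tt, hj, hd] at e
          simp [colr, psum, z1, z2]
          revert e
          generalize psum x a = s; generalize psum y j = t; generalize x (a + 1) = u; generalize y j = v
          generalize x a = w
          revert s t u v w; decide
        · omega
        · have z2 : b < j + 1 := by omega
          have z3 : ¬ j < b := by omega
          have z4 : ¬ j = b := by omega
          simp [tt, z3, z4, hd] at e
          simp [colr, psum, hj, z2]
          revert e c1 c2
          generalize psum x a = s; generalize psum y j = t; generalize x (a + 1) = u; generalize y j = v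
          generalize x a = w; generalize y b = w'
          revert s t u v w w'; decide
      · simp [tt, hi, hi', hd] at e
        simp [colr, psum, hi, hi']
        revert e
        generalize psum x i = s; generalize psum y j = t; generalize x i = u; generalize y j = v
        revert s t u v; decide
  · have e := h k j (by omega) (by omega)
    by_cases hi : k = a
    · subst hi
      rcases lt_trichotomy j b with hj | hj | hj
      · have z1 : ¬ b < j := by omega
        have z2 : ¬ b < j + 1 := by omega
        simp [tt, hj, hd] at e
        simp [colr, psum, z1, z2]
        revert e
        generalize psum x k = s; generalize psum y j = t; generalize x k = u; generalize y j = v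
        revert s t u v; decide
      · omega
      · have z2 : b < j + 1 := by omega
        have z3 : ¬ j < b := by omega
        have z4 : ¬ j = b := by omega
        simp [tt, z3, z4, hd] at e
        simp [colr, psum, hj, z2]
        revert e
        generalize psum x k = s; generalize psum y j = t; generalize x k = u; generalize y j = v
        revert s t u v; decide
    · by_cases hi' : k = a + 1
      · subst hi'
        rcases lt_trichotomy j b with hj | hj | hj
        · have z1 : ¬ b < j := by omega
          have z2 : ¬ b < j + 1 := by omega
          simp [tt, hj, hd] at e
          simp [colr, psum, z1, z2]
          revert e
          generalize psum x a = s; generalize psum y j = t; generalize x (a + 1) = u; generalize y j = v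
          generalize x a = w
          revert s t u v w; decide
        · omega
        · have z2 : b < j + 1 := by omega
          have z3 : ¬ j < b := by omega
          have z4 : ¬ j = b := by omega
          simp [tt, z3, z4, hd] at e
          simp [colr, psum, hj, z2]
          revert e c1 c2
          generalize psum x a = s; generalize psum y j = t; generalize x (a + 1) = u; generalize y j = v
          generalize x a = w; generalize y b = w'
          revert s t u v w w'; decide
      · simp [tt, hi, hi', hd] at e
        simp [colr, psum, hi, hi']
        revert e
        generalize psum x k = s; generalize psum y j = t; generalize x k = u; generalize y j = v
        revert s t u v; decide
  · rcases hR with ⟨⟨h1, h2⟩, h3, h4⟩ | ⟨⟨h1, h2⟩, h3, h4⟩ | ⟨⟨h1, h2⟩, h3, h4⟩ <;>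
      rw [h1, h2, h3, h4] <;> simp only [colr, psum] <;> simp <;> revert c1 c2 <;>
      generalize psum x a = s <;> generalize psum y b = t <;> generalize x a = w <;>
      generalize x (a + 1) = u <;> generalize y b = v <;> revert s t u v w <;> decide
  · rcases hR with ⟨⟨h1, h2⟩, h3, h4⟩ | ⟨⟨h1, h2⟩, h3, h4⟩ | ⟨⟨h1, h2⟩, h3, h4⟩ <;>
      rw [h1, h2, h3, h4] <;> simp only [colr, psum] <;> simp <;> revert c1 c2 <;>
      generalize psum x a = s <;> generalize psum y b = t <;> generalize x a = w <;>
      generalize x (a + 1) = u <;> generalize y b = v <;> revert s t u v w <;> decide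

theorem col_of_word {a b m n : ℕ} {diag : ℕ → ℕ → Bool} {dom : Bool} (ha : a + 2 ≤ m)
    (hb : b + 1 ≤ n) (hw : WordRepresentable (dominoTriangulationH m n a b diag dom)) :
    (dominoTriangulationH m n a b diag dom).Colorable 3 := by
  obtain ⟨x, y, h⟩ := rank_one (tt a b diag) (interior_tt ha hb hw)
  have C : (dominoTriangulationH m n a b diag dom).Coloring (ZMod 3) :=
    SimpleGraph.Coloring.mk (fun v => colr a b x y v.1) (by
      intro u v huv
      rw [adj_iff] at huv
      rcases huv with huv | huv
      · exact colr_ne ha hb x y h _ _ u.2.1 u.2.2 v.2.1 v.2.2 huv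
      · exact (colr_ne ha hb x y h _ _ v.2.1 v.2.2 u.2.1 u.2.2 huv).symm)
  exact C.colorable

theorem grid_finite (m n : ℕ) : Finite (GridV m n) := by
  apply Finite.of_injective (β := Fin (m + 1) × Fin (n + 1))
    (fun p => (⟨p.1.1, by have := p.2.1; omega⟩, ⟨p.1.2, by have := p.2.2; omega⟩))
  rintro ⟨⟨x, y⟩, h⟩ ⟨⟨z, t⟩, h'⟩ e
  simpa using e

theorem word_iso {V W : Type*} [DecidableEq V] [DecidableEq W] (G : SimpleGraph V)
    (e : W ≃ V) (h : WordRepresentable (G.comap e)) : WordRepresentable G := by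
  obtain ⟨w, h1, h2⟩ := h
  refine ⟨w.map e, ?_, ?_⟩
  · intro v
    rw [List.mem_map]
    exact ⟨e.symm v, h1 _, by simp⟩
  · intro x y hxy
    have := h2 (e.symm x) (e.symm y) (by simpa using hxy)
    simp only [SimpleGraph.comap_adj, Equiv.apply_symm_apply] at this
    rw [this]
    unfold Alternates List.Chain'
    rw [List.filter_map, List.isChain_map]
    have e1 : ((fun z => decide (z = x ∨ z = y)) ∘ e) =
        (fun z => decide (z = e.symm x ∨ z = e.symm y)) := by
      funext z
      simp [Equiv.eq_symm_apply]
    rw [e1]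
    simp
/-- Every triangulation of a rectangular polyomino with a single domino tile (horizontal
or vertical) is word-representable if and only if it is 3-colourable. -/
theorem dominoTriangulation_wordRepresentable_iff_colorable :
    (∀ (m n a b : ℕ), 2 ≤ m → 1 ≤ n → a + 2 ≤ m → b + 1 ≤ n →
      ∀ (diag : ℕ → ℕ → Bool) (dom : Bool),
        (WordRepresentable (dominoTriangulationH m n a b diag dom) ↔
          (dominoTriangulationH m n a b diag dom).Colorable 3)) ∧
    (∀ (m n a b : ℕ), 1 ≤ m → 2 ≤ n → a + 1 ≤ m → b + 2 ≤ n →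
      ∀ (diag : ℕ → ℕ → Bool) (dom : Bool),
        (WordRepresentable (dominoTriangulationV m n a b diag dom) ↔
          (dominoTriangulationV m n a b diag dom).Colorable 3)) := by
  constructor
  · intro m n a b _ _ ha hb diag dom
    have := grid_finite m n
    exact ⟨col_of_word ha hb, wordRep_of_col _⟩
  · intro m n a b _ _ ha hb diag dom
    have := grid_finite m n
    refine ⟨fun h => ?_, wordRep_of_col _⟩
    let e : GridV m n ≃ GridV n m :=
      { toFun := fun p => ⟨(p.1.2, p.1.1), p.2.2, p.2.1⟩
        invFun := fun p => ⟨(p.1.2, p.1.1), p.2.2, p.2.1⟩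
        left_inv := fun p => rfl
        right_inv := fun p => rfl }
    have h1 : WordRepresentable (dominoTriangulationH n m b a diag dom) := word_iso _ e h
    obtain ⟨C⟩ := col_of_word hb ha h1
    exact ⟨SimpleGraph.Coloring.mk (fun v => C (e v)) (fun {u v} huv => C.valid huv)⟩
end

section
/- For every integer t ≥ 2, the odd wheel W_{2t+1} is not word-representable. -/
/-- The wheel graph `W_n` on `n + 1` vertices: a cycle on the `n` vertices `Sum.inl i`
(`i : Fin n`), together with one new hub vertex `Sum.inr ()` adjacent to all of them. -/
def wheelGraph (n : ℕ) : SimpleGraph (Fin n ⊕ Unit) :=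
  SimpleGraph.fromRel fun a b =>
    match a, b with
    | Sum.inl i, Sum.inl j => ((i : ℕ) + 1) % n = (j : ℕ)
    | Sum.inl _, Sum.inr _ => True
    | _, _ => False

def DD {V : Type*} [DecidableEq V] (w : List V) (x y : V) : Prop :=
  ∀ k, (w.take k).count y ≤ (w.take k).count x ∧ (w.take k).count x ≤ (w.take k).count y + 1

theorem DD_cons {V : Type*} [DecidableEq V] (z : V) (w : List V) (x y : V) :
    DD (z :: w) x y ↔ ∀ k, ((w.take k).count y + (if z = y then 1 else 0) ≤
        (w.take k).count x + (if z = x then 1 else 0) ∧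
      (w.take k).count x + (if z = x then 1 else 0) ≤
        (w.take k).count y + (if z = y then 1 else 0) + 1) := by
  constructor
  · intro h k
    have := h (k + 1)
    simpa [List.take_succ_cons, List.count_cons] using this
  · intro h k
    cases k with
    | zero => simp
    | succ k =>
      have := h k
      simpa [List.take_succ_cons, List.count_cons] using this

theorem DD_iff {V : Type*} [DecidableEq V] (w : List V) : ∀ x y : V, x ≠ y →
    (DD w x y ↔ List.IsChain (· ≠ ·) (y :: w.filter fun z => z = x ∨ z = y)) := by
  induction w with
  | nil => intro x y _; simp [DD]
  | cons z w ih =>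
    intro x y hxy
    rw [DD_cons]
    by_cases hx : z = x
    · subst hx
      have e : (List.filter (fun a => decide (a = z ∨ a = y)) (z :: w)) =
          z :: w.filter (fun a => decide (a = y ∨ a = z)) := by
        simp [or_comm]
      rw [e, List.isChain_cons_cons, ← ih y z hxy.symm]
      simp only [hxy, hxy.symm, ne_eq, not_false_eq_true, true_and, if_true, if_false]
      refine forall_congr' fun k => ?_
      omega
    · by_cases hy : z = y
      · subst hy
        have e : (List.filter (fun a => decide (a = x ∨ a = z)) (z :: w)) =
            z :: w.filter (fun a => decide (a = x ∨ a = z)) := by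
          simp
        rw [e, List.isChain_cons_cons]
        simp only [ne_eq, not_true_eq_false, false_and, iff_false]
        intro h
        have := h 0
        simp [hx] at this
      · have e : (List.filter (fun a => decide (a = x ∨ a = y)) (z :: w)) =
            w.filter (fun a => decide (a = x ∨ a = y)) := by
          simp [hx, hy]
        rw [e, ← ih x y hxy]
        simp [hx, hy, DD]

theorem alternates_iff {V : Type*} [DecidableEq V] (w : List V) (x y : V) (hxy : x ≠ y) :
    Alternates w x y ↔ DD w x y ∨ DD w y x := by
  rw [DD_iff w x y hxy, DD_iff w y x hxy.symm]
  have e : (w.filter fun z => z = y ∨ z = x) = (w.filter fun z => z = x ∨ z = y) := by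
    simp [or_comm]
  rw [e]
  unfold Alternates List.Chain'
  have hm : ∀ a ∈ (w.filter fun z => z = x ∨ z = y), a = x ∨ a = y := by
    intro a ha
    simpa using (List.mem_filter.1 ha).2
  generalize (w.filter fun z => z = x ∨ z = y) = F at hm
  cases F with
  | nil => simp
  | cons a F =>
    rw [List.isChain_cons_cons, List.isChain_cons_cons]
    rcases hm a (by simp) with h | h <;> subst h <;> simp [hxy, hxy.symm]

theorem exists_poset {V : Type*} [DecidableEq V] (w : List V) (h : V)
    (hh : ∀ x, x ≠ h → Alternates w x h) :
    ∃ f : V → ℕ → ℕ, ∀ x y, x ≠ h → y ≠ h → x ≠ y →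
      (Alternates w x y ↔ f x ≤ f y ∨ f y ≤ f x) := by
  classical
  refine ⟨fun x k => (w.take k).count x + (if DD w x h then 0 else 1), ?_⟩
  intro x y hx hy hxy
  rw [alternates_iff w x y hxy]
  have ax := (alternates_iff w x h hx).1 (hh x hx)
  have ay := (alternates_iff w y h hy).1 (hh y hy)
  simp only [Pi.le_def]
  by_cases h1 : DD w x h <;> by_cases h2 : DD w y h <;>
    simp only [h1, h2, if_true, if_false, false_or] at ax ay ⊢
  · constructor
    · rintro (d | d)
      · exact Or.inr fun k => by have := d k; omega
      · exact Or.inl fun k => by have := d k; omega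
    · rintro (d | d)
      · exact Or.inr fun k => by have := d k; have := h1 k; have := h2 k; omega
      · exact Or.inl fun k => by have := d k; have := h1 k; have := h2 k; omega
  · constructor
    · rintro (d | d)
      · exact Or.inl fun k => by have := d k; omega
      · exact Or.inl fun k => by have := d k; omega
    · rintro (d | d)
      · exact Or.inl fun k => by have := d k; have := h1 k; have := ay k; omega
      · have := d 0
        simp at this
  · constructor
    · rintro (d | d)
      · exact Or.inr fun k => by have := d k; omega
      · exact Or.inr fun k => by have := d k; omega
    · rintro (d | d)
      · have := d 0
        simp at this
      · exact Or.inr fun k => by have := d k; have := ax k; have := h2 k; omega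
  · constructor
    · rintro (d | d)
      · exact Or.inr fun k => by have := d k; omega
      · exact Or.inl fun k => by have := d k; omega
    · rintro (d | d)
      · exact Or.inr fun k => by have := d k; have := ax k; have := ay k; omega
      · exact Or.inl fun k => by have := d k; have := ax k; have := ay k; omega

/-- For every integer `t ≥ 2`, the odd wheel `W_{2t+1}` is not word-representable. -/
theorem oddWheel_not_wordRepresentable :
    ∀ t : ℕ, 2 ≤ t → ¬ WordRepresentable (wheelGraph (2 * t + 1)) := by
  intro t ht ⟨w, _, hw⟩
  obtain ⟨f, hf⟩ := exists_poset w (Sum.inr () : Fin (2 * t + 1) ⊕ Unit) (by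
    intro x hx
    rw [← hw x _ hx]
    rcases x with i | u
    · simp [wheelGraph]
    · exact absurd rfl hx)
  have hn : 0 < 2 * t + 1 := by omega
  let v : ℕ → Fin (2 * t + 1) := fun i => ⟨i % (2 * t + 1), Nat.mod_lt _ hn⟩
  let F : ℕ → ℕ → ℕ := fun i => f (Sum.inl (v i))
  have key : ∀ i j, v i ≠ v j →
      (((v i : ℕ) + 1) % (2 * t + 1) = (v j : ℕ) ∨ ((v j : ℕ) + 1) % (2 * t + 1) = (v i : ℕ)
        ↔ F i ≤ F j ∨ F j ≤ F i) := by
    intro i j hij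
    have hne : (Sum.inl (v i) : Fin (2 * t + 1) ⊕ Unit) ≠ Sum.inl (v j) := by
      simpa using hij
    rw [← hf _ _ (by simp) (by simp) hne, ← hw _ _ hne]
    simp [wheelGraph, hij]
  have hs : ∀ a, (a % (2 * t + 1) + 1 < 2 * t + 1 ∧ (a + 1) % (2 * t + 1) = a % (2 * t + 1) + 1) ∨
      (a % (2 * t + 1) + 1 = 2 * t + 1 ∧ (a + 1) % (2 * t + 1) = 0) := by
    intro a
    have h1 := Nat.mod_lt a hn
    rw [Nat.add_mod, Nat.mod_eq_of_lt (show 1 < 2 * t + 1 by omega)]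
    rcases Nat.lt_or_ge (a % (2 * t + 1) + 1) (2 * t + 1) with h | h
    · left; exact ⟨h, Nat.mod_eq_of_lt h⟩
    · right
      have : a % (2 * t + 1) + 1 = 2 * t + 1 := by omega
      exact ⟨this, by rw [this, Nat.mod_self]⟩
  have h1 : ∀ i, F i ≤ F (i + 1) ∨ F (i + 1) ≤ F i := by
    intro i
    refine (key i (i + 1) ?_).1 (Or.inl ?_)
    · intro h
      have h : i % (2 * t + 1) = (i + 1) % (2 * t + 1) := congrArg Fin.val h
      have := hs i
      omega
    · simp [v]
  have h2 : ∀ i, ¬ (F i ≤ F (i + 2) ∨ F (i + 2) ≤ F i) := by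
    intro i
    have a0 := hs i
    have a1 := hs (i + 1)
    have a2 := hs (i + 2)
    rw [← key i (i + 2)]
    · simp only [v, Nat.mod_add_mod]
      rw [show i + 1 + 1 = i + 2 from rfl] at a1
      generalize (i + 2 + 1) % (2 * t + 1) = p3 at *
      generalize (i + 2) % (2 * t + 1) = p2 at *
      generalize (i + 1) % (2 * t + 1) = p1 at *
      generalize i % (2 * t + 1) = p0 at *
      omega
    · intro h
      have h : i % (2 * t + 1) = (i + 2) % (2 * t + 1) := congrArg Fin.val h
      have e : i + 1 + 1 = i + 2 := rfl
      rw [e] at a1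
      omega
  have h3 : ∀ i, (F (i + 1) ≤ F (i + 2) ↔ ¬ F i ≤ F (i + 1)) := by
    intro i
    constructor
    · intro a b
      exact h2 i (Or.inl (b.trans a))
    · intro a
      have b := (h1 i).resolve_left a
      by_contra c
      have d := (h1 (i + 1)).resolve_left c
      exact h2 i (Or.inr (d.trans b))
  have h4 : ∀ s, (F (2 * s) ≤ F (2 * s + 1) ↔ F 0 ≤ F 1) := by
    intro s
    induction s with
    | zero => simp
    | succ s ih =>
      have a := h3 (2 * s)
      have b := h3 (2 * s + 1)
      rw [show 2 * (s + 1) = 2 * s + 1 + 1 by ring, b, a, ih, not_not]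
  have h5 := h3 (2 * t)
  rw [h4 t] at h5
  have e1 : F (2 * t + 1) = F 0 := by simp [F, v]
  have e2 : F (2 * t + 2) = F 1 := by
    have : v (2 * t + 2) = v 1 := by
      apply Fin.ext
      change (2 * t + 1 + 1) % (2 * t + 1) = 1 % (2 * t + 1)
      simp
    simp only [F, this]
  rw [e1, e2] at h5
  tauto
end

section
/- The graph A2 contains the wheel W_7 as an induced subgraph; consequently A2 is not 3-colourable and is not word-representable. -/
/-- The simple graph on `V` whose edges are (the unordered versions of) the pairs
occurring in the list `l`. -/
def graphOfList {V : Type*} (l : List (V × V)) : SimpleGraph V :=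
  SimpleGraph.fromRel fun a b => (a, b) ∈ l

def edgesA2 : List ((Fin 4 × Fin 3) × (Fin 4 × Fin 3)) :=
  [
    ((0, 0), (1, 0)), ((0, 0), (0, 1)), ((0, 1), (1, 1)), ((1, 0), (2, 0)), ((1, 1), (2, 1)),
    ((1, 1), (1, 2)), ((1, 2), (2, 2)), ((2, 0), (3, 0)), ((2, 0), (2, 1)), ((2, 1), (3, 1)),
    ((2, 1), (2, 2)), ((2, 2), (3, 2)), ((3, 0), (3, 1)), ((3, 1), (3, 2)), ((2, 1), (3, 0)),
    ((0, 0), (2, 1)), ((0, 0), (1, 1)), ((1, 0), (2, 1)), ((1, 1), (2, 2)), ((2, 2), (3, 1))]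

/-- The graph `A2` from the paper, with vertex set
`{(x,y) : 0 ≤ x ≤ 3, 0 ≤ y ≤ 2} \ {(0, 2)}`. -/
def graphA2 : SimpleGraph {p : Fin 4 × Fin 3 | p ≠ (0, 2)} :=
  (graphOfList edgesA2).induce {p : Fin 4 × Fin 3 | p ≠ (0, 2)}

theorem chain_cons_filter_iff {V : Type*} [DecidableEq V] (w : List V) :
    ∀ x y : V, x ≠ y →
    (List.IsChain (· ≠ ·) (x :: w.filter fun z => z = x ∨ z = y) ↔
      ∀ p, (w.take p).count x ≤ (w.take p).count y ∧
        (w.take p).count y ≤ (w.take p).count x + 1) := by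
  induction w with
  | nil => intro x y _; simp
  | cons a l ih =>
    intro x y hxy
    by_cases hax : a = x
    · subst hax
      constructor
      · intro h
        simp at h
      · intro h
        have := (h 1).1
        simp [hxy] at this
    · by_cases hay : a = y
      · subst hay
        have e : (l.filter fun z => z = x ∨ z = a) = l.filter fun z => z = a ∨ z = x := by
          congr 1; funext z; simp [or_comm]
        have := ih a x hax
        rw [List.filter_cons_of_pos (by simp), List.isChain_cons_cons, e, this]
        constructor
        · rintro ⟨_, h⟩ p
          cases p with
          | zero => simp
          | succ p =>
            have := h p
            simp [hax]
            omega
        · intro h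
          refine ⟨hxy, fun p => ?_⟩
          have := h (p+1)
          simp [hax] at this
          omega
      · rw [List.filter_cons_of_neg (by simp [hax, hay]), ih x y hxy]
        constructor
        · intro h p
          cases p with
          | zero => simp
          | succ p =>
            have := h p
            simp [hax, hay]
            omega
        · intro h p
          have := h (p+1)
          simp [hax, hay] at this
          omega

theorem alternates_iff_count {V : Type*} [DecidableEq V] (w : List V) (x y : V) (hxy : x ≠ y) :
    Alternates w x y ↔
      (∀ p, (w.take p).count x ≤ (w.take p).count y ∧
        (w.take p).count y ≤ (w.take p).count x + 1) ∨
      (∀ p, (w.take p).count y ≤ (w.take p).count x ∧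
        (w.take p).count x ≤ (w.take p).count y + 1) := by
  rw [← chain_cons_filter_iff w x y hxy, ← chain_cons_filter_iff w y x hxy.symm]
  have e : (w.filter fun z => z = y ∨ z = x) = w.filter fun z => z = x ∨ z = y := by
    congr 1; funext z; simp [or_comm]
  rw [e]
  change List.IsChain (· ≠ ·) (w.filter fun z => z = x ∨ z = y) ↔ _
  have hm : ∀ z ∈ (w.filter fun z => z = x ∨ z = y), z = x ∨ z = y := by
    intro z hz
    simpa using (List.mem_filter.1 hz).2
  generalize (w.filter fun z => z = x ∨ z = y) = l at hm
  cases l with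
  | nil => simp
  | cons a l =>
    rw [List.isChain_cons_cons, List.isChain_cons_cons]
    rcases hm a (by simp) with rfl | rfl
    · simp [hxy.symm]
    · simp [hxy]

theorem hub_order {V : Type*} [DecidableEq V] (G : SimpleGraph V) (hG : WordRepresentable G)
    (h : V) : ∃ le : V → V → Prop, (∀ a b c, le a b → le b c → le a c) ∧
      ∀ u v, G.Adj u h → G.Adj v h → u ≠ v → (G.Adj u v ↔ le u v ∨ le v u) := by
  obtain ⟨w, -, hw⟩ := hG
  have key : ∀ u, ∃ e : ℕ, e ≤ 1 ∧ (G.Adj u h → ∀ p, (w.take p).count h ≤ (w.take p).count u + e ∧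
      (w.take p).count u + e ≤ (w.take p).count h + 1) := by
    intro u
    by_cases hu : G.Adj u h
    · rcases (alternates_iff_count w u h hu.ne).1 ((hw u h hu.ne).1 hu) with H | H
      · exact ⟨1, le_rfl, fun _ p => by have := H p; omega⟩
      · exact ⟨0, by simp, fun _ p => by have := H p; omega⟩
    · exact ⟨0, by simp, fun h' => absurd h' hu⟩
  choose e he hk using key
  refine ⟨fun u v => ∀ p, (w.take p).count u + e u ≤ (w.take p).count v + e v,
    fun a b c h1 h2 p => (h1 p).trans (h2 p), ?_⟩
  intro u v hu hv huv
  have ku := hk u hu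
  have kv := hk v hv
  have eu := he u
  have ev := he v
  rw [hw u v huv, alternates_iff_count w u v huv]
  constructor
  · rintro (H | H)
    · by_cases c : e u = 1 ∧ e v = 0
      · right; intro p; have := H p; omega
      · left; intro p; have := H p; have := ku p; have := kv p; omega
    · by_cases c : e v = 1 ∧ e u = 0
      · left; intro p; have := H p; omega
      · right; intro p; have := H p; have := ku p; have := kv p; omega
  · rintro (H | H)
    · have h0 := H 0
      simp at h0
      by_cases c : e u = e v
      · left; intro p; have := H p; have := ku p; have := kv p; omega
      · right; intro p; have := H p; have := ku p; have := kv p; omega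
    · have h0 := H 0
      simp at h0
      by_cases c : e u = e v
      · right; intro p; have := H p; have := ku p; have := kv p; omega
      · left; intro p; have := H p; have := ku p; have := kv p; omega

instance decAdjA2 : DecidableRel graphA2.Adj := fun a b =>
  decidable_of_iff (a.1 ≠ b.1 ∧ ((a.1, b.1) ∈ edgesA2 ∨ (b.1, a.1) ∈ edgesA2)) Iff.rfl

def rimA2 : Fin 7 → {p : Fin 4 × Fin 3 | p ≠ (0, 2)}
  | 0 => ⟨(1, 1), by decide⟩
  | 1 => ⟨(0, 0), by decide⟩
  | 2 => ⟨(1, 0), by decide⟩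
  | 3 => ⟨(2, 0), by decide⟩
  | 4 => ⟨(3, 0), by decide⟩
  | 5 => ⟨(3, 1), by decide⟩
  | 6 => ⟨(2, 2), by decide⟩

def hubA2 : {p : Fin 4 × Fin 3 | p ≠ (0, 2)} := ⟨(2, 1), by decide⟩

theorem rim_hub (i : Fin 7) : graphA2.Adj (rimA2 i) hubA2 := by
  revert i; decide

theorem rim_inj : ∀ i j : Fin 7, rimA2 i = rimA2 j → i = j := by decide

theorem rim_ne_hub : ∀ i : Fin 7, rimA2 i ≠ hubA2 := by decide

theorem rim_adj : ∀ i j : Fin 7, graphA2.Adj (rimA2 i) (rimA2 j) ↔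
    (i ≠ j ∧ (((i : ℕ) + 1) % 7 = (j : ℕ) ∨ ((j : ℕ) + 1) % 7 = (i : ℕ))) := by decide

/-- The graph `A2` contains the wheel `W_7` as an induced subgraph; consequently `A2`
is not 3-colourable and is not word-representable. -/
theorem graphA2_wheel7_not_colorable_not_wordRepresentable :
    Nonempty (wheelGraph 7 ↪g graphA2) ∧
      ¬ graphA2.Colorable 3 ∧ ¬ WordRepresentable graphA2 := by
  refine ⟨⟨⟨⟨Sum.elim rimA2 fun _ => hubA2, ?_⟩, ?_⟩⟩, ?_, ?_⟩
  · rintro (i | i) (j | j) h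
    · exact congrArg _ (rim_inj i j h)
    · exact absurd h (rim_ne_hub i)
    · exact absurd h.symm (rim_ne_hub j)
    · rfl
  · rintro (i | i) (j | j)
    · exact (rim_adj i j).trans (by simp [wheelGraph])
    · exact iff_of_true (rim_hub i) (by simp [wheelGraph])
    · exact iff_of_true (rim_hub j).symm (by simp [wheelGraph])
    · simp [wheelGraph]
  · rintro ⟨c⟩
    have hh := fun i => c.valid (rim_hub i)
    have hr := fun i : Fin 7 => c.valid ((rim_adj i (i+1)).2 (by revert i; decide))
    generalize c hubA2 = x at hh
    have h2 : ∀ i : Fin 7, c (rimA2 (i+2)) = c (rimA2 i) := by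
      intro i
      have a := hh i
      have b := hh (i+1)
      have d := hh (i+2)
      have f := hr i
      have g := hr (i+1)
      rw [show i + 1 + 1 = i + 2 by clear * -; revert i; decide] at g
      omega
    have e0 := h2 0
    have e2 := h2 2
    have e4 := h2 4
    have e6 := hr 6
    simp at e0 e2 e4 e6
    exact e6 (e4.trans (e2.trans e0))
  · intro hG
    obtain ⟨le, ht, hle⟩ := hub_order graphA2 hG hubA2
    have adj : ∀ i : Fin 7, le (rimA2 i) (rimA2 (i+1)) ∨ le (rimA2 (i+1)) (rimA2 i) := fun i =>
      (hle _ _ (rim_hub _) (rim_hub _) (by revert i; decide)).1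
        ((rim_adj i (i+1)).2 (by revert i; decide))
    have nadj : ∀ i : Fin 7, ¬ (le (rimA2 i) (rimA2 (i+2)) ∨ le (rimA2 (i+2)) (rimA2 i)) :=
      fun i h => (by clear h; revert i; decide : ¬ graphA2.Adj (rimA2 i) (rimA2 (i+2)))
        ((hle _ _ (rim_hub _) (rim_hub _) (by clear h; revert i; decide)).2 h)
    have e : ∀ i : Fin 7, i + 1 + 1 = i + 2 := by decide
    have up : ∀ i : Fin 7, le (rimA2 i) (rimA2 (i+1)) → le (rimA2 (i+2)) (rimA2 (i+1)) := by
      intro i h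
      have a := adj (i+1)
      rw [e] at a
      rcases a with a | a
      · exact absurd (Or.inl (ht _ _ _ h a)) (nadj i)
      · exact a
    have dn : ∀ i : Fin 7, le (rimA2 (i+1)) (rimA2 i) → le (rimA2 (i+1)) (rimA2 (i+2)) := by
      intro i h
      have a := adj (i+1)
      rw [e] at a
      rcases a with a | a
      · exact a
      · exact absurd (Or.inr (ht _ _ _ a h)) (nadj i)
    have up2 : ∀ i : Fin 7, le (rimA2 i) (rimA2 (i+1)) → le (rimA2 (i+2)) (rimA2 (i+3)) := by
      intro i h
      have := dn (i+1) (by rw [e]; exact up i h)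
      rwa [e, show i + 1 + 2 = i + 3 by clear * -; revert i; decide] at this
    have dn2 : ∀ i : Fin 7, le (rimA2 (i+1)) (rimA2 i) → le (rimA2 (i+3)) (rimA2 (i+2)) := by
      intro i h
      have := up (i+1) (by rw [e]; exact dn i h)
      rwa [e, show i + 1 + 2 = i + 3 by clear * -; revert i; decide] at this
    rcases adj 0 with h | h
    · exact nadj 6 (Or.inl (ht _ _ _ (up2 4 (up2 2 (up2 0 h))) h))
    · exact nadj 6 (Or.inr (ht _ _ _ h (dn2 4 (dn2 2 (dn2 0 h)))))
end

section
/- The graph A4 contains the wheel W_5 as an induced subgraph; consequently A4 is not 3-colourable and is not word-representable. -/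
def edgesA4 : List ((Fin 4 × Fin 3) × (Fin 4 × Fin 3)) :=
  [
    ((0, 0), (1, 0)), ((0, 0), (0, 1)), ((0, 1), (1, 1)), ((1, 0), (2, 0)), ((1, 1), (2, 1)),
    ((1, 1), (1, 2)), ((1, 2), (2, 2)), ((2, 0), (3, 0)), ((2, 0), (2, 1)), ((2, 1), (3, 1)),
    ((2, 1), (2, 2)), ((2, 2), (3, 2)), ((3, 0), (3, 1)), ((3, 1), (3, 2)), ((2, 1), (3, 0)),
    ((0, 1), (1, 0)), ((0, 1), (2, 0)), ((1, 1), (2, 0)), ((1, 1), (2, 2)), ((2, 2), (3, 1))]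

/-- The graph `A4` from the paper, with vertex set
`{(x,y) : 0 ≤ x ≤ 3, 0 ≤ y ≤ 2} \ {(0, 2)}`. -/
def graphA4 : SimpleGraph {p : Fin 4 × Fin 3 | p ≠ (0, 2)} :=
  (graphOfList edgesA4).induce {p : Fin 4 × Fin 3 | p ≠ (0, 2)}

/-- Balance of the letters `x`, `y` over all prefixes. -/
def Bal {V : Type*} [DecidableEq V] (w : List V) (x y : V) (c : ℤ) : Prop :=
  ∀ n, 0 ≤ c + ((w.take n).count x : ℤ) - ((w.take n).count y : ℤ) ∧
    c + ((w.take n).count x : ℤ) - ((w.take n).count y : ℤ) ≤ 1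

theorem bal_nil {V : Type*} [DecidableEq V] (x y : V) (c : ℤ) :
    Bal [] x y c ↔ 0 ≤ c ∧ c ≤ 1 := by
  simp [Bal]

theorem bal_cons {V : Type*} [DecidableEq V] (a : V) (w : List V) (x y : V) (c : ℤ) :
    Bal (a :: w) x y c ↔ (0 ≤ c ∧ c ≤ 1) ∧
      Bal w x y (c + (if a = x then 1 else 0) - (if a = y then 1 else 0)) := by
  constructor
  · intro h
    refine ⟨by simpa using h 0, fun n => ?_⟩
    have := h (n + 1)
    simp only [List.take_succ_cons, List.count_cons, beq_iff_eq] at this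
    push_cast at this
    constructor <;> linarith [this.1, this.2]
  · rintro ⟨h0, h⟩ n
    cases n with
    | zero => simpa using h0
    | succ n =>
      have := h n
      simp only [List.take_succ_cons, List.count_cons, beq_iff_eq]
      push_cast
      constructor <;> linarith [this.1, this.2]

theorem bal_range {V : Type*} [DecidableEq V] {w : List V} {x y : V} {c : ℤ}
    (h : Bal w x y c) : 0 ≤ c ∧ c ≤ 1 := by simpa using h 0

theorem bal_chain {V : Type*} [DecidableEq V] (w : List V) (x y : V) (hxy : x ≠ y) :
    (Bal w x y 0 ↔ List.IsChain (· ≠ ·) (y :: w.filter fun z => z = x ∨ z = y)) ∧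
    (Bal w x y 1 ↔ List.IsChain (· ≠ ·) (x :: w.filter fun z => z = x ∨ z = y)) := by
  induction w with
  | nil => simp [bal_nil]
  | cons a w ih =>
    rw [bal_cons, bal_cons]
    have h2 : ¬ Bal w x y 2 := fun h => by have := bal_range h; omega
    have h3 : ¬ Bal w x y (-1) := fun h => by have := bal_range h; omega
    by_cases hx : a = x
    · subst hx
      simp [hxy, hxy.symm, ih.2, h2]
    · by_cases hy : a = y
      · subst hy
        simp [hxy, hx, ih.1, h3]
      · simp [hx, hy, ih.1, ih.2]

theorem alt_iff_s12 {V : Type*} [DecidableEq V] (w : List V) (x y : V) (hxy : x ≠ y) :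
    Alternates w x y ↔ ∃ c, Bal w x y c := by
  have key := bal_chain w x y hxy
  constructor
  · intro h
    have h : List.IsChain (· ≠ ·) (w.filter fun z => z = x ∨ z = y) := h
    cases hl : (w.filter fun z => z = x ∨ z = y) with
    | nil => exact ⟨0, key.1.2 (by rw [hl]; simp)⟩
    | cons b l =>
      by_cases hb : b = y
      · exact ⟨1, key.2.2 (by rw [hl] at h ⊢; exact List.isChain_cons_cons.2 ⟨hb ▸ hxy, h⟩)⟩
      · exact ⟨0, key.1.2 (by rw [hl] at h ⊢; exact List.isChain_cons_cons.2 ⟨Ne.symm hb, h⟩)⟩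
  · rintro ⟨c, hc⟩
    have hr := bal_range hc
    change List.IsChain (· ≠ ·) (w.filter fun z => z = x ∨ z = y)
    obtain rfl | rfl : c = 0 ∨ c = 1 := by omega
    · exact (key.1.1 hc).tail
    · exact (key.2.1 hc).tail

theorem neighbourhood_dir {V : Type*} [DecidableEq V] (w : List V) (h x y : V) (cx cy : ℤ)
    (hx : Bal w x h cx) (hy : Bal w y h cy) (hxy : ∃ c, Bal w x y c) :
    Bal w x y (cx - cy) ∨ Bal w y x (cy - cx) := by
  obtain ⟨c, hc⟩ := hxy
  by_cases hle : c ≤ cx - cy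
  · left; intro n
    have := hx n; have := hy n; have := hc n
    by_cases he : c = cx - cy
    · omega
    · constructor <;> omega
  · right; intro n
    have := hx n; have := hy n; have := hc n
    constructor <;> omega

theorem neighbourhood_trans {V : Type*} [DecidableEq V] (w : List V) (h x y z : V)
    (cx cy cz : ℤ) (hx : Bal w x h cx) (hz : Bal w z h cz)
    (hxy : Bal w x y (cx - cy)) (hyz : Bal w y z (cy - cz)) : Bal w x z (cx - cz) := by
  intro n
  have := hx n; have := hz n; have := hxy n; have := hyz n
  constructor <;> omega

theorem no_wheel5 {V : Type*} [DecidableEq V] (G : SimpleGraph V) (h a b c d e : V)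
    (ha : G.Adj a h) (hb : G.Adj b h) (hc : G.Adj c h) (hd : G.Adj d h) (he : G.Adj e h)
    (hab : G.Adj a b) (hbc : G.Adj b c) (hcd : G.Adj c d) (hde : G.Adj d e) (hea : G.Adj e a)
    (hac : ¬ G.Adj a c) (hbd : ¬ G.Adj b d) (hce : ¬ G.Adj c e) (hda : ¬ G.Adj d a)
    (heb : ¬ G.Adj e b) (nac : a ≠ c) (nbd : b ≠ d) (nce : c ≠ e) (nda : d ≠ a)
    (neb : e ≠ b) : ¬ WordRepresentable G := by
  rintro ⟨w, -, hw⟩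
  have E : ∀ x y, G.Adj x y → ∃ c, Bal w x y c := fun x y hh =>
    (alt_iff_s12 w x y hh.ne).1 ((hw x y hh.ne).1 hh)
  have N : ∀ x y, ¬ G.Adj x y → x ≠ y → ∀ c, ¬ Bal w x y c := fun x y hh hn c hc =>
    hh ((hw x y hn).2 ((alt_iff_s12 w x y hn).2 ⟨c, hc⟩))
  obtain ⟨ka, Ha⟩ := E _ _ ha
  obtain ⟨kb, Hb⟩ := E _ _ hb
  obtain ⟨kc, Hc⟩ := E _ _ hc
  obtain ⟨kd, Hd⟩ := E _ _ hd
  obtain ⟨ke, He⟩ := E _ _ he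
  have T : ∀ x y z cx cy cz, Bal w x h cx → Bal w z h cz → ¬ G.Adj x z → x ≠ z →
      ¬ (Bal w x y (cx - cy) ∧ Bal w y z (cy - cz)) ∧
      ¬ (Bal w z y (cz - cy) ∧ Bal w y x (cy - cx)) :=
    fun x y z cx cy cz hx hz hn hne =>
      ⟨fun hh => N x z hn hne _ (neighbourhood_trans w h x y z cx cy cz hx hz hh.1 hh.2),
       fun hh => N z x (fun q => hn q.symm) hne.symm _
        (neighbourhood_trans w h z y x cz cy cx hz hx hh.1 hh.2)⟩
  have t1 := T a b c ka kb kc Ha Hc hac nac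
  have t2 := T b c d kb kc kd Hb Hd hbd nbd
  have t3 := T c d e kc kd ke Hc He hce nce
  have t4 := T d e a kd ke ka Hd Ha hda nda
  have t5 := T e a b ke ka kb He Hb heb neb
  have d1 := neighbourhood_dir w h a b ka kb Ha Hb (E _ _ hab)
  have d2 := neighbourhood_dir w h b c kb kc Hb Hc (E _ _ hbc)
  have d3 := neighbourhood_dir w h c d kc kd Hc Hd (E _ _ hcd)
  have d4 := neighbourhood_dir w h d e kd ke Hd He (E _ _ hde)
  have d5 := neighbourhood_dir w h e a ke ka He Ha (E _ _ hea)
  clear T N E hw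
  rcases d1 with d1 | d1 <;> rcases d2 with d2 | d2 <;> rcases d3 with d3 | d3 <;>
    rcases d4 with d4 | d4 <;> rcases d5 with d5 | d5 <;> simp_all only [and_self, not_true_eq_false, and_false, false_and]

/-- The embedding of the wheel. -/
def wheelMap : Fin 5 ⊕ Unit → {p : Fin 4 × Fin 3 | p ≠ (0, 2)}
  | Sum.inl i => ![⟨(1, 1), by decide⟩, ⟨(2, 0), by decide⟩, ⟨(3, 0), by decide⟩,
      ⟨(3, 1), by decide⟩, ⟨(2, 2), by decide⟩] i
  | Sum.inr _ => ⟨(2, 1), by decide⟩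

theorem adjA4 (p q : {p : Fin 4 × Fin 3 | p ≠ (0, 2)}) : graphA4.Adj p q ↔
    (p.1 ≠ q.1 ∧ ((p.1, q.1) ∈ edgesA4 ∨ (q.1, p.1) ∈ edgesA4)) := Iff.rfl

theorem wheelMap_inj : Function.Injective wheelMap := by
  have : ∀ a b, (wheelMap a).1 = (wheelMap b).1 → a = b := by decide
  exact fun a b h => this a b (congrArg _ h)

theorem wheelMap_adj (a b : Fin 5 ⊕ Unit) :
    graphA4.Adj (wheelMap a) (wheelMap b) ↔ (wheelGraph 5).Adj a b := by
  rw [adjA4]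
  rcases a with i | ⟨⟩ <;> rcases b with j | ⟨⟩
  · simp only [wheelGraph, SimpleGraph.fromRel_adj]
    revert i j; decide
  · simp only [wheelGraph, SimpleGraph.fromRel_adj, ne_eq, reduceCtorEq, not_false_eq_true, or_false, false_or, and_self, iff_true]
    decide +revert
  · simp only [wheelGraph, SimpleGraph.fromRel_adj, ne_eq, reduceCtorEq, not_false_eq_true, or_false, false_or, and_self, iff_true]
    decide +revert
  · simp

theorem graphA4_wheel5_not_colorable_not_wordRepresentable :
    Nonempty (wheelGraph 5 ↪g graphA4) ∧
      ¬ graphA4.Colorable 3 ∧ ¬ WordRepresentable graphA4 := by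
  have hub : ∀ i : Fin 5, graphA4.Adj (wheelMap (.inl i)) (wheelMap (.inr ())) := by
    intro i; rw [adjA4]; revert i; decide
  have cyc : ∀ i : Fin 5, graphA4.Adj (wheelMap (.inl i)) (wheelMap (.inl (i + 1))) := by
    intro i; rw [adjA4]; revert i; decide
  have non : ∀ i : Fin 5, ¬ graphA4.Adj (wheelMap (.inl i)) (wheelMap (.inl (i + 2))) := by
    intro i; rw [adjA4]; revert i; decide
  have ne : ∀ i : Fin 5, wheelMap (.inl i) ≠ wheelMap (.inl (i + 2)) := by
    intro i hi
    have := wheelMap_inj hi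
    revert i; decide
  refine ⟨⟨⟨⟨wheelMap, wheelMap_inj⟩, fun {a b} => wheelMap_adj a b⟩⟩, ?_, ?_⟩
  · rintro ⟨C⟩
    have H : ∀ i, C (wheelMap (.inl i)) ≠ C (wheelMap (.inr ())) := fun i => C.valid (hub i)
    have K : ∀ i, C (wheelMap (.inl i)) ≠ C (wheelMap (.inl (i + 1))) := fun i => C.valid (cyc i)
    generalize C (wheelMap (.inr ())) = h at H
    have h0 := H 0; have h1 := H 1; have h2 := H 2; have h3 := H 3; have h4 := H 4
    have k0 := K 0; have k1 := K 1; have k2 := K 2; have k3 := K 3; have k4 := K 4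
    simp only [Fin.reduceAdd] at k0 k1 k2 k3 k4
    clear H K
    omega
  · exact no_wheel5 graphA4 (wheelMap (.inr ())) (wheelMap (.inl 0)) (wheelMap (.inl 1))
      (wheelMap (.inl 2)) (wheelMap (.inl 3)) (wheelMap (.inl 4))
      (hub 0) (hub 1) (hub 2) (hub 3) (hub 4) (cyc 0) (cyc 1) (cyc 2) (cyc 3) (cyc 4)
      (non 0) (non 1) (non 2) (non 3) (non 4) (ne 0) (ne 1) (ne 2) (ne 3) (ne 4)
end
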